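/- arXiv:2503.23845 — 5 statements merged into one kernel-verified Lean document; each statement's English description precedes it below -/
import Mathlib

section
/- Let G be a finite group, H a subgroup, and t a positive integer. Let n = |G : H| and, for x ∈ G, let fix(x) denote the number of cosets ω in the coset space G/H with x·ω = ω. If the sum of (fix(x)/n)^t over all elements x ∈ G of prime order is strictly less than 1, then there exist g₁, …, g_t ∈ G such that ⋂_{i=1}^{t} g_i H g_i⁻¹ is the trivial subgroup. -/
noncomputable section

/-- The usual inner product of class functions on a finite group `H`. -/
def charInner (H : Type) (φ ψ : H → ℂ) : ℂ :=
  (Nat.card H : ℂ)⁻¹ * ∑ᶠ h : H, φ h * (starRingEnd ℂ) (ψ h)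

/-- `χ : H → ℂ` is the character of an irreducible complex representation of `H`. -/
def IsIrrChar (H : Type) [Group H] (χ : H → ℂ) : Prop :=
  ∃ V : FDRep ℂ H, CategoryTheory.Simple V ∧ χ = V.character

/-- Restriction of a class function on `G` to a subgroup `H`. -/
def resChar {G : Type} [Group G] (H : Subgroup G) (χ : G → ℂ) : ↥H → ℂ :=
  fun h => χ (h : G)

/-- Two irreducible characters `α, β` of a subgroup `H ≤ G` are linked over `G` if some
irreducible character `χ` of `G` satisfies `⟨χ|_H, α⟩ ≠ 0` and `⟨χ|_H, β⟩ ≠ 0`. -/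
def Linked {G : Type} [Group G] (H : Subgroup G) (α β : ↥H → ℂ) : Prop :=
  ∃ χ : G → ℂ, IsIrrChar G χ ∧
    charInner ↥H (resChar H χ) α ≠ 0 ∧ charInner ↥H (resChar H χ) β ≠ 0

/-- `α` and `β` are joined by a path of length at most `m` in the Külshammer graph
`K(G,H)`: there is a chain of irreducible characters of `H`, of length `k ≤ m`, from `α`
to `β` in which consecutive members are linked over `G`. -/
def LinkedPathLE {G : Type} [Group G] (H : Subgroup G) (m : ℕ) (α β : ↥H → ℂ) : Prop :=
  ∃ k ≤ m, ∃ f : ℕ → (↥H → ℂ), f 0 = α ∧ f k = β ∧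
    (∀ i ≤ k, IsIrrChar ↥H (f i)) ∧ ∀ i < k, Linked H (f i) (f (i + 1))

/-- The conjugate subgroup `g H g⁻¹`. -/
def conjSub {G : Type} [Group G] (g : G) (H : Subgroup G) : Subgroup G :=
  H.map (MulAut.conj g).toMonoidHom

/-- The stabilizer of the coset `gH` is `gHg⁻¹`. -/
theorem mem_conjSub_iff_smul_mk_eq {G : Type} [Group G] {H : Subgroup G} {g x : G} :
    x ∈ conjSub g H ↔ x • (g : G ⧸ H) = (g : G ⧸ H) := by
  rw [eq_comm, MulAction.Quotient.smul_coe, QuotientGroup.eq, conjSub,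
    Subgroup.mem_map_equiv, MulAut.conj_symm_apply, smul_eq_mul, mul_assoc]

/-- A nontrivial finite subgroup contains an element of prime order. -/
theorem Subgroup.exists_mem_prime_orderOf {G : Type*} [Group G] [Finite G] {K : Subgroup G}
    (hK : K ≠ ⊥) : ∃ x ∈ K, (orderOf x).Prime := by
  have hcard : Nat.card K ≠ 1 := fun h => hK (Subgroup.card_eq_one.mp h)
  obtain ⟨p, hp, hdvd⟩ := Nat.exists_prime_and_dvd hcard
  have : Fact p.Prime := ⟨hp⟩
  obtain ⟨x, hx⟩ := exists_prime_orderOf_dvd_card' p hdvd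
  exact ⟨x, x.2, by rwa [Subgroup.orderOf_coe, hx]⟩

/-- Union bound: if the densities of the sets of `t`-tuples fixed pointwise by the elements of `S`
sum to less than `1`, then some `t`-tuple is fixed pointwise by no element of `S`. -/
theorem exists_tuple_forall_exists_smul_ne {G α : Type*} [SMul G α] [Finite α] [Nonempty α]
    (S : Finset G) (t : ℕ)
    (h : ∑ x ∈ S, ((Nat.card {a : α // x • a = a} : ℝ) / (Nat.card α : ℝ)) ^ t < 1) :
    ∃ ω : Fin t → α, ∀ x ∈ S, ∃ i, x • ω i ≠ ω i := by
  classical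
  have := Fintype.ofFinite α
  by_contra! hcover
  have huniv : (Finset.univ : Finset (Fin t → α)) ⊆
      S.biUnion fun x => Fintype.piFinset fun _ => {a | x • a = a} := by
    intro ω _
    obtain ⟨x, hx, hfix⟩ := hcover ω
    simp only [Finset.mem_biUnion, Fintype.mem_piFinset, Finset.mem_filter_univ]
    exact ⟨x, hx, hfix⟩
  have hle := (Finset.card_le_card huniv).trans Finset.card_biUnion_le
  simp only [Finset.card_univ, Fintype.card_piFinset, Finset.prod_const,
    ← Fintype.card_subtype, ← Nat.card_eq_fintype_card, Nat.card_fun, Nat.card_fin] at hle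
  simp only [div_pow, ← Finset.sum_div] at h
  have hle' : (Nat.card α : ℝ) ^ t ≤
      ∑ x ∈ S, (Nat.card {a : α // x • a = a} : ℝ) ^ t := by exact_mod_cast hle
  have hpos : (0 : ℝ) < (Nat.card α : ℝ) ^ t := pow_pos (Nat.cast_pos.mpr Nat.card_pos) t
  rw [div_lt_one hpos] at h
  exact h.not_ge hle'

/-- If `G` is a finite group, `H ≤ G`, `n = |G : H|`, and the sum of
`(fix(x)/n)^t` over the elements `x ∈ G` of prime order is less than `1`, then some `t`
conjugates of `H` intersect trivially. -/
theorem probabilistic_base {G : Type} [Group G] [Fintype G] (H : Subgroup G)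
    (t : ℕ) (ht : 0 < t)
    (hsum : ∑ x : G, (if (orderOf x).Prime then
        ((Nat.card {ω : G ⧸ H // x • ω = ω} : ℝ) / (H.index : ℝ)) ^ t else 0) < 1) :
    ∃ g : Fin t → G, (⨅ i, conjSub (g i) H) = ⊥ := by
  classical
  obtain ⟨ω, hω⟩ := exists_tuple_forall_exists_smul_ne (α := G ⧸ H)
    {x : G | (orderOf x).Prime} t (by rwa [Finset.sum_filter])
  refine ⟨fun i => (ω i).out, ?_⟩
  by_contra hne
  obtain ⟨x, hx, hprime⟩ := Subgroup.exists_mem_prime_orderOf hne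
  obtain ⟨i, hi⟩ := hω x (by simpa using hprime)
  have hxi := mem_conjSub_iff_smul_mk_eq.mp (Subgroup.mem_iInf.mp hx i)
  rw [QuotientGroup.out_eq'] at hxi
  exact hi hxi
end
end

section
/- Let G be a finite group and H a subgroup such that H ∩ xHx⁻¹ is the trivial subgroup for some x ∈ G (i.e., the base size of G acting on G/H is at most 2). Then any two irreducible complex characters α, β of H are linked over G: there exists an irreducible complex character χ of G with ⟨χ|_H, α⟩ ≠ 0 and ⟨χ|_H, β⟩ ≠ 0. Equivalently, the Külshammer graph K(G,H) is complete, so that when H is nontrivial and core-free the depth of H in G equals 3. -/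
noncomputable section

open MonoidAlgebra Matrix
open scoped ComplexOrder

/-- A finite group of complex matrices is unitarizable; hence traces of inverse elements are
complex conjugate. -/
theorem Matrix.trace_map_inv_eq_star {H n : Type*} [Group H] [Finite H] [Fintype n]
    [DecidableEq n] (ρ : H →* Matrix n n ℂ) (h : H) :
    (ρ h⁻¹).trace = star (ρ h).trace := by
  have := Fintype.ofFinite H
  set M : Matrix n n ℂ := ∑ g, (ρ g)ᴴ * ρ g with hM
  have hpos : M.PosDef := by
    refine Matrix.posDef_sum Finset.univ_nonempty fun g _ => ?_
    exact Matrix.PosDef.conjTranspose_mul_self _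
      (mulVec_injective_of_isUnit ((Group.isUnit g).map ρ))
  have hinv : (ρ h)ᴴ * M * ρ h = M := by
    rw [hM, Finset.mul_sum, Finset.sum_mul, ← Equiv.sum_comp (Equiv.mulRight h) (fun g => (ρ g)ᴴ * ρ g)]
    refine Finset.sum_congr rfl fun g _ => ?_
    simp [mul_assoc]
  have hcomm : M * ρ h⁻¹ = (ρ h)ᴴ * M := by
    conv_lhs => rw [← hinv]
    rw [mul_assoc, ← map_mul, mul_inv_cancel, map_one, mul_one]
  have hdet := (Matrix.isUnit_iff_isUnit_det M).mp hpos.isUnit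
  calc (ρ h⁻¹).trace = (M⁻¹ * (M * ρ h⁻¹)).trace := by
        rw [Matrix.nonsing_inv_mul_cancel_left _ _ hdet]
    _ = ((ρ h)ᴴ * M * M⁻¹).trace := by rw [hcomm, Matrix.trace_mul_comm]
    _ = star (ρ h).trace := by
        rw [Matrix.mul_nonsing_inv_cancel_right _ _ hdet, Matrix.trace_conjTranspose]

theorem Representation.character_inv_eq_conj {H V : Type*} [Group H] [Finite H]
    [AddCommGroup V] [Module ℂ V] [FiniteDimensional ℂ V] (τ : Representation ℂ H V) (h : H) :
    τ.character h⁻¹ = (starRingEnd ℂ) (τ.character h) := by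
  let b := Module.finBasis ℂ V
  have := Matrix.trace_map_inv_eq_star
    ((LinearMap.toMatrixAlgEquiv b).toMulEquiv.toMonoidHom.comp τ) h
  simpa only [Representation.character, LinearMap.trace_eq_matrix_trace ℂ b] using! this

theorem FDRep.simple_of_isIrreducible {G V : Type} [Group G] [Finite G] [AddCommGroup V]
    [Module ℂ V] [FiniteDimensional ℂ V] (ρ : Representation ℂ G V) [ρ.IsIrreducible] :
    CategoryTheory.Simple (FDRep.of ρ) := by
  have := Fintype.ofFinite G
  have := invertibleOfNonzero (NeZero.ne (Nat.card G : ℂ))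
  rw [FDRep.simple_iff_char_is_norm_one]
  have h := Representation.char_orthonormal ρ ρ
  rw [if_pos ⟨Representation.Equiv.refl ρ⟩, inv_mul_eq_one₀ (NeZero.ne _)] at h
  exact h.symm

theorem Representation.asAlgebraHom_ofModule_apply_eq_smul {G M : Type*} [Group G] [AddCommGroup M]
    [Module ℂ M] [Module (MonoidAlgebra ℂ G) M] [IsScalarTower ℂ (MonoidAlgebra ℂ G) M]
    (a : MonoidAlgebra ℂ G) (m : M) :
    (Representation.ofModule' (k := ℂ) (G := G) M).asAlgebraHom a m = a • m :=
  LinearMap.congr_fun (DFunLike.congr_fun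
    ((MonoidAlgebra.lift ℂ (Module.End ℂ M) G).apply_symm_apply (Algebra.lsmul ℂ ℂ M)) a) m

/-- A simple module over the group algebra gives an irreducible representation with the same
action. -/
theorem MonoidAlgebra.exists_simple_asAlgebraHom_ne_zero_of_smul_ne_zero {G M : Type} [Group G]
    [Finite G] [AddCommGroup M] [Module ℂ M] [Module (MonoidAlgebra ℂ G) M]
    [IsScalarTower ℂ (MonoidAlgebra ℂ G) M] [IsSimpleModule (MonoidAlgebra ℂ G) M]
    {a : MonoidAlgebra ℂ G} {s : M} (hs : a • s ≠ 0) :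
    ∃ V : FDRep ℂ G, CategoryTheory.Simple V ∧ Representation.asAlgebraHom V.ρ a ≠ 0 := by
  have hfin : FiniteDimensional ℂ M := Module.Finite.trans (MonoidAlgebra ℂ G) M
  let ρ : Representation ℂ G M := Representation.ofModule' M
  let e : ρ.asModule ≃ₗ[MonoidAlgebra ℂ G] M :=
    { ρ.asModuleEquiv with
      map_smul' := fun r m => (ρ.asModuleEquiv_map_smul r m).trans
        (Representation.asAlgebraHom_ofModule_apply_eq_smul r _) }
  have hirr : ρ.IsIrreducible :=
    ρ.irreducible_iff_isSimpleModule_asModule.mpr (IsSimpleModule.congr e)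
  refine ⟨FDRep.of ρ, FDRep.simple_of_isIrreducible ρ, fun h0 => hs ?_⟩
  rw [← Representation.asAlgebraHom_ofModule_apply_eq_smul]
  exact LinearMap.congr_fun h0 s

/-- A nonzero element of the group algebra acts nontrivially on some irreducible
representation. -/
theorem MonoidAlgebra.exists_simple_asAlgebraHom_ne_zero {G : Type} [Group G] [Finite G]
    {a : MonoidAlgebra ℂ G} (ha : a ≠ 0) :
    ∃ V : FDRep ℂ G, CategoryTheory.Simple V ∧ Representation.asAlgebraHom V.ρ a ≠ 0 := by
  obtain ⟨S, hS, s, hs⟩ : ∃ S : Submodule (MonoidAlgebra ℂ G) (MonoidAlgebra ℂ G),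
      IsSimpleModule (MonoidAlgebra ℂ G) S ∧ ∃ s : S, a • s ≠ 0 := by
    by_contra! hcon
    have h1 : (1 : MonoidAlgebra ℂ G) ∈
        sSup {m : Submodule (MonoidAlgebra ℂ G) (MonoidAlgebra ℂ G) |
          IsSimpleModule (MonoidAlgebra ℂ G) m} := by
      rw [IsSemisimpleModule.sSup_simples_eq_top]
      trivial
    rw [sSup_eq_iSup'] at h1
    refine ha ?_
    rw [← mul_one a]
    refine Submodule.iSup_induction _ (motive := fun y => a * y = 0) h1 ?_ (mul_zero a) ?_
    · rintro ⟨S, hS⟩ y hy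
      exact congrArg Subtype.val (hcon S hS ⟨y, hy⟩)
    · intro y z hy hz
      rw [mul_add, hy, hz, add_zero]
  exact exists_simple_asAlgebraHom_ne_zero_of_smul_ne_zero (M := S) hs

/-- The element `∑ h, f (h⁻¹ u) h` of the group algebra of `G` attached to a matrix coefficient
of a representation of a subgroup. -/
def coeffElement {G V : Type*} [Group G] (H : Subgroup G) [Fintype H] [AddCommGroup V]
    [Module ℂ V] (τ : Representation ℂ H V) (f : Module.Dual ℂ V) (u : V) : MonoidAlgebra ℂ G :=
  ∑ h : H, single (h : G) (f (τ h⁻¹ u))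

theorem charInner_resChar_ne_zero {G V S : Type} [Group G] {H : Subgroup G} [Fintype H]
    [AddCommGroup V] [Module ℂ V] [FiniteDimensional ℂ V]
    [AddCommGroup S] [Module ℂ S] [FiniteDimensional ℂ S]
    (σ : Representation ℂ G S) (τ : Representation ℂ H V) (f : Module.Dual ℂ V) (u : V)
    (hne : σ.asAlgebraHom (coeffElement H τ f u) ≠ 0) :
    charInner H (resChar H σ.character) τ.character ≠ 0 := by
  have := invertibleOfNonzero (NeZero.ne (Nat.card H : ℂ))
  let σH : Representation ℂ H S := σ.comp H.subtype
  have hinner : charInner H (resChar H σ.character) τ.character =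
      Module.finrank ℂ (τ.IntertwiningMap σH) := by
    rw [← Representation.card_inv_mul_sum_char_mul_char_eq_finrank, charInner,
      finsum_eq_sum_of_fintype]
    simp_rw [Representation.character_inv_eq_conj]
    rfl
  rw [hinner, Nat.cast_ne_zero]
  intro h0
  refine hne (LinearMap.ext fun s => ?_)
  let T : τ.IntertwiningMap σH :=
    LinearMap.intertwiningMap_of_isIntertwiningMap _ _
      (∑ h : H, (f ∘ₗ τ h⁻¹).smulRight (σ h s)) fun k v => by
        simp only [LinearMap.sum_apply, LinearMap.smulRight_apply, LinearMap.comp_apply, map_sum,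
          map_smul]
        rw [← Equiv.sum_comp (Equiv.mulLeft k)]
        refine Finset.sum_congr rfl fun h _ => ?_
        simp [σH, ← Module.End.mul_apply, ← map_mul, mul_assoc]
  have hfin : FiniteDimensional ℂ (τ.IntertwiningMap σH) :=
    (Representation.invariantsEquivIntertwiningMap τ σH).finiteDimensional
  have hT : T = 0 := (Module.finrank_zero_iff.mp h0).elim _ _
  have hTu : T u = ∑ h : H, f (τ h⁻¹ u) • σ h s := by
    change (∑ h : H, (f ∘ₗ τ h⁻¹).smulRight (σ h s)) u = _
    simp
  rw [hT] at hTu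
  simpa [coeffElement] using hTu.symm

/-- If `H ∩ xHx⁻¹ = 1` then the elements `h x k` with `h, k ∈ H` are distinct, so the
coefficient at `x` of a product `a x b` is the product of the coefficients of `a`, `b` at `1`. -/
theorem coeffElement_mul_single_mul_ne_zero {G : Type} {V W : Type*} [Group G] {H : Subgroup G} [Fintype H]
    {x : G} (hx : H ⊓ conjSub x H = ⊥)
    [AddCommGroup V] [Module ℂ V] [AddCommGroup W] [Module ℂ W]
    (τ : Representation ℂ H V) (f : Module.Dual ℂ V) (u : V) (hu : f u ≠ 0)
    (ω : Representation ℂ H W) (g : Module.Dual ℂ W) (w : W) (hw : g w ≠ 0) :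
    coeffElement H τ f u * single x 1 * coeffElement H ω g w ≠ 0 := by
  classical
  have hfix (h k : H) : (h : G) * x * k = x ↔ h = 1 ∧ k = 1 := by
    refine ⟨fun e => ?_, by rintro ⟨rfl, rfl⟩; simp⟩
    have hh : (h : G) ∈ H ⊓ conjSub x H := by
      refine ⟨h.2, (k⁻¹ : H), (k⁻¹).2, ?_⟩
      simp only [MulEquiv.toMonoidHom_eq_coe, MonoidHom.coe_coe, MulAut.conj_apply,
        InvMemClass.coe_inv]
      rw [← eq_mul_inv_iff_mul_eq] at e
      rw [← e, mul_inv_cancel_right]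
    rw [hx, Subgroup.mem_bot] at hh
    rw [hh, one_mul, mul_eq_left] at e
    exact ⟨Subtype.ext hh, Subtype.ext e⟩
  intro h0
  have hcoeff := congrArg (fun a : MonoidAlgebra ℂ G => a.coeff x) h0
  simp [coeffElement, Finset.sum_mul, Finset.mul_sum, Finsupp.single_apply, hfix, ite_and,
    hu, hw] at hcoeff

theorem exists_dual_ne_zero_of_simple {H : Type} [Group H] (V : FDRep ℂ H)
    (hV : CategoryTheory.Simple V) : ∃ (f : Module.Dual ℂ V) (u : V), f u ≠ 0 := by
  have hnt : Nontrivial V := by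
    by_contra hsub
    rw [not_nontrivial_iff_subsingleton] at hsub
    refine CategoryTheory.id_nonzero V ?_
    ext v
    exact Subsingleton.elim _ _
  obtain ⟨u, hu⟩ := exists_ne (0 : V)
  obtain ⟨f, hf⟩ := Module.Projective.exists_dual_ne_zero ℂ hu
  exact ⟨f, u, hf⟩

/-- If some conjugate of `H` meets `H` trivially (base size at most 2),
then any two irreducible complex characters of `H` are linked over `G`, i.e. the
Külshammer graph `K(G,H)` is complete (so a nontrivial core-free such `H` has depth 3). -/
theorem baseTwo_linked {G : Type} [Group G] [Finite G] (H : Subgroup G)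
    (hbase : ∃ x : G, H ⊓ conjSub x H = ⊥) :
    ∀ α β : ↥H → ℂ, IsIrrChar ↥H α → IsIrrChar ↥H β → Linked H α β := by
  rintro _ _ ⟨V, hV, rfl⟩ ⟨W, hW, rfl⟩
  obtain ⟨x, hx⟩ := hbase
  have := Fintype.ofFinite H
  obtain ⟨f, u, hu⟩ := exists_dual_ne_zero_of_simple V hV
  obtain ⟨g, w, hw⟩ := exists_dual_ne_zero_of_simple W hW
  obtain ⟨S, hS, hne⟩ := MonoidAlgebra.exists_simple_asAlgebraHom_ne_zero
    (coeffElement_mul_single_mul_ne_zero hx V.ρ f u hu W.ρ g w hw)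
  rw [map_mul, map_mul] at hne
  exact ⟨S.character, ⟨S, hS, rfl⟩,
    charInner_resChar_ne_zero S.ρ V.ρ f u (left_ne_zero_of_mul (left_ne_zero_of_mul hne)),
    charInner_resChar_ne_zero S.ρ W.ρ g w (right_ne_zero_of_mul hne)⟩
end
end

section
/- Let G = S₈ be the symmetric group on 8 letters and let P be a Sylow 2-subgroup of G (so |P| = 2⁷). Then: (i) P ∩ xPx⁻¹ is nontrivial for every x ∈ G; (ii) there exist x, y ∈ G with P ∩ xPx⁻¹ ∩ yPy⁻¹ trivial (so the base size b(G,P) equals 3); and (iii) there exist irreducible complex characters α, β of P that are not linked over G, i.e., no irreducible complex character of G restricts to P containing both α and β (so the Külshammer graph K(G,P) is not complete and d_G(P) > 3). -/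
noncomputable section

/-- A homomorphism to `{1, -1}` is an irreducible character. -/
theorem isIrrChar_of_hom {H : Type} [Group H] [Finite H] (φ : H →* ℤˣ) :
    IsIrrChar H (fun h => ((φ h : ℤ) : ℂ)) := by
  have := Fintype.ofFinite H
  let r : Representation ℂ H ℂ :=
    ((algebraMap ℂ (Module.End ℂ ℂ)).toMonoidHom.comp (Int.castRingHom ℂ).toMonoidHom).comp
      ((Units.coeHom ℤ).comp φ)
  have hr : ∀ h, (FDRep.of r).character h = ((φ h : ℤ) : ℂ) := by
    intro h
    change LinearMap.trace ℂ ℂ (algebraMap ℂ (Module.End ℂ ℂ) ((φ h : ℤ) : ℂ)) = _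
    rw [Algebra.algebraMap_eq_smul_one, map_smul, LinearMap.trace_one]
    simp
  refine ⟨FDRep.of r, ?_, funext fun h => (hr h).symm⟩
  rw [FDRep.simple_iff_char_is_norm_one]
  simp only [hr, map_inv, ← Int.cast_mul, ← Units.val_mul, mul_inv_cancel]
  simp

/-- If for every `g` there is an element `u = g v g⁻¹` of `H ∩ g H g⁻¹` with
`φ u = -1`, then the trivial character of `H` and `φ` are not linked. -/
theorem not_linked_one_of_hom {G : Type} [Group G] [Finite G] (H : Subgroup G) (φ : H →* ℤˣ)
    (hφ : ∀ g : G, ∃ u v : H, (u : G) * g = g * v ∧ φ u = -1) :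
    ¬ Linked H (fun _ => 1) (fun h => ((φ h : ℤ) : ℂ)) := by
  rintro ⟨χ, ⟨V, hV, rfl⟩, h₁, h₂⟩
  have := Fintype.ofFinite G
  have := Fintype.ofFinite H
  let e₁ : Module.End ℂ V := ∑ h : H, V.ρ h
  let e₂ : Module.End ℂ V := ∑ h : H, ((φ h : ℤ) : ℂ) • V.ρ h
  have he₁ : LinearMap.trace ℂ V e₁ ≠ 0 := by
    intro h
    apply h₁
    rw [map_sum] at h
    rw [charInner, finsum_eq_sum_of_fintype]
    simpa [resChar, FDRep.character] using h
  have he₂ : e₂ ≠ 0 := by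
    intro h
    apply h₂
    have h := congrArg (LinearMap.trace ℂ V) h
    rw [map_sum, map_zero] at h
    rw [charInner, finsum_eq_sum_of_fintype]
    simpa [resChar, FDRep.character, mul_comm] using h
  have left₂ : ∀ u : H, e₂ * V.ρ u = ((φ u : ℤ) : ℂ) • e₂ := by
    intro u
    simp only [e₂, Finset.sum_mul, Finset.smul_sum, smul_mul_assoc, smul_smul]
    refine Fintype.sum_equiv (Equiv.mulRight u) _ _ fun h => ?_
    rw [Equiv.coe_mulRight, map_mul, mul_comm (φ h), ← Int.cast_mul, ← Units.val_mul, ← mul_assoc,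
      Int.units_mul_self, one_mul, Subgroup.coe_mul, map_mul]
  have right₁ : ∀ v : H, V.ρ v * e₁ = e₁ := by
    intro v
    simp only [e₁, Finset.mul_sum, ← map_mul]
    exact Fintype.sum_equiv (Equiv.mulLeft v) _ _ fun h => rfl
  have ortho : ∀ g : G, e₂ * V.ρ g * e₁ = 0 := by
    intro g
    obtain ⟨u, v, huv, hu⟩ := hφ g
    have h : e₂ * V.ρ u * V.ρ g * e₁ = e₂ * V.ρ g * e₁ := by
      rw [mul_assoc e₂, ← map_mul, huv, map_mul, mul_assoc, mul_assoc, right₁, mul_assoc]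
    rw [left₂, hu] at h
    simp only [Units.val_neg, Units.val_one, Int.cast_neg, Int.cast_one, neg_smul, one_smul,
      neg_mul] at h
    rwa [neg_eq_iff_add_eq_zero, ← two_smul ℂ, smul_eq_zero_iff_right two_ne_zero] at h
  let A : Module.End ℂ V := ∑ g : G, V.ρ g * e₁ * V.ρ g⁻¹
  have hA : ∀ g : G, V.ρ g * A = A * V.ρ g := by
    intro g
    simp only [A, Finset.mul_sum, Finset.sum_mul]
    refine Fintype.sum_equiv (Equiv.mulLeft g) _ _ fun h => ?_
    rw [Equiv.coe_mulLeft, mul_assoc _ _ (V.ρ g), ← map_mul, mul_inv_rev, inv_mul_cancel_right,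
      map_mul, ← mul_assoc, ← mul_assoc]
  have htr : LinearMap.trace ℂ V A ≠ 0 := by
    have h : ∀ g : G, LinearMap.trace ℂ V (V.ρ g * e₁ * V.ρ g⁻¹) = LinearMap.trace ℂ V e₁ := by
      intro g
      rw [LinearMap.trace_mul_comm, ← mul_assoc, ← map_mul]
      simp
    simp only [A, map_sum, h]
    simpa using he₁
  have hA₂ : e₂ * A = 0 := by
    simp only [A, Finset.mul_sum, ← mul_assoc, ortho, zero_mul, Finset.sum_const_zero]
  let f : V ⟶ V := ⟨CategoryTheory.InducedCategory.homMk (ModuleCat.ofHom A), fun g => by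
    ext1
    ext v
    exact (LinearMap.congr_fun (hA g) v).symm⟩
  have hf : f ≠ 0 := by
    intro h
    have hA0 : A = 0 := congrArg (fun k : V ⟶ V => k.hom.hom.hom) h
    exact htr (by rw [hA0, map_zero])
  have := (CategoryTheory.isIso_iff_nonzero f).mpr hf
  let B : Module.End ℂ V := (CategoryTheory.inv f).hom.hom.hom
  have hAB : A * B = 1 :=
    congrArg (fun k : V ⟶ V => k.hom.hom.hom) (CategoryTheory.IsIso.inv_hom_id f)
  exact he₂ (by rw [← mul_one e₂, ← hAB, ← mul_assoc, hA₂, zero_mul])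

open Equiv (swap)

/-- The automorphism group of the complete binary tree with eight leaves, as the group of compatible
permutations of the eight leaves, the four nodes above them and the two nodes above those. -/
def treeGroup : Subgroup (Equiv.Perm (Fin 8) × Equiv.Perm (Fin 4) × Equiv.Perm (Fin 2)) where
  carrier := {t | (∀ i : Fin 8, (t.1 i : ℕ) / 2 = t.2.1 ⟨i / 2, by omega⟩) ∧
    ∀ j : Fin 4, (t.2.1 j : ℕ) / 2 = t.2.2 ⟨j / 2, by omega⟩}
  one_mem' := by simp
  mul_mem' := by
    rintro s t ⟨hs₁, hs₂⟩ ⟨ht₁, ht₂⟩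
    refine ⟨fun i => ?_, fun j => ?_⟩
    · simp only [Prod.fst_mul, Prod.snd_mul, Equiv.Perm.mul_apply, hs₁, ht₁]
    · simp only [Prod.fst_mul, Prod.snd_mul, Equiv.Perm.mul_apply, hs₂, ht₂]
  inv_mem' := by
    rintro t ⟨ht₁, ht₂⟩
    refine ⟨fun i => ?_, fun j => ?_⟩
    · have h := ht₁ (t.1⁻¹ i)
      rw [Equiv.Perm.inv_def, Equiv.apply_symm_apply] at h
      have h' : t.2.1⁻¹ ⟨i / 2, by omega⟩ = ⟨(t.1⁻¹ i : ℕ) / 2, by omega⟩ := by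
        rw [Equiv.Perm.inv_eq_iff_eq]
        exact Fin.ext h
      simp only [Prod.fst_inv, Prod.snd_inv, h']
    · have h := ht₂ (t.2.1⁻¹ j)
      rw [Equiv.Perm.inv_def, Equiv.apply_symm_apply] at h
      have h' : t.2.2⁻¹ ⟨j / 2, by omega⟩ = ⟨(t.2.1⁻¹ j : ℕ) / 2, by omega⟩ := by
        rw [Equiv.Perm.inv_eq_iff_eq]
        exact Fin.ext h
      simp only [Prod.fst_inv, Prod.snd_inv, h']

/-- The action of the tree group on the leaves. -/
def leafHom : treeGroup →* Equiv.Perm (Fin 8) :=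
  (MonoidHom.fst _ _).comp treeGroup.subtype

/-- The product of the signs of the actions on the three levels of the tree. -/
def treeSign : treeGroup →* ℤˣ :=
  (Equiv.Perm.sign.comp leafHom) *
    (Equiv.Perm.sign.comp ((MonoidHom.fst _ _).comp ((MonoidHom.snd _ _).comp treeGroup.subtype)) *
      Equiv.Perm.sign.comp ((MonoidHom.snd _ _).comp ((MonoidHom.snd _ _).comp treeGroup.subtype)))

theorem leafHom_div_two (t : treeGroup) (i : Fin 8) :
    (leafHom t i : ℕ) / 2 = t.1.2.1 ⟨i / 2, by omega⟩ :=
  t.2.1 i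

theorem leafHom_div_four (t : treeGroup) (i : Fin 8) :
    (leafHom t i : ℕ) / 2 / 2 = t.1.2.2 ⟨i / 2 / 2, by omega⟩ := by
  rw [leafHom_div_two, t.2.2]

theorem leafHom_div_two_congr (t : treeGroup) {i j : Fin 8} (h : (i : ℕ) / 2 = j / 2) :
    (leafHom t i : ℕ) / 2 = leafHom t j / 2 := by
  simp only [leafHom_div_two, h]

theorem leafHom_div_four_congr (t : treeGroup) {i j : Fin 8} (h : (i : ℕ) / 2 / 2 = j / 2 / 2) :
    (leafHom t i : ℕ) / 2 / 2 = leafHom t j / 2 / 2 := by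
  simp only [leafHom_div_four, h]

theorem leafHom_injective : Function.Injective leafHom := by
  rw [injective_iff_map_eq_one]
  rintro ⟨⟨a, b, c⟩, h₁, h₂⟩ (rfl : a = 1)
  have hb : b = 1 := by
    ext j
    simpa using (h₁ ⟨2 * j, by omega⟩).symm
  subst hb
  have hc : c = 1 := by
    ext j
    simpa using (h₂ ⟨2 * j, by omega⟩).symm
  subst hc
  rfl

/-- A permutation preserving the fibres of `i ↦ i / 2` squares to the identity. -/
theorem sq_eq_one_of_div_two {n : ℕ} (a : Equiv.Perm (Fin n))
    (h : ∀ i, (a i : ℕ) / 2 = i / 2) : a ^ 2 = 1 := by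
  ext i
  rw [sq, Equiv.Perm.mul_apply, Equiv.Perm.one_apply]
  have h₁ := h i
  have h₂ := h (a i)
  by_cases hi : a i = i
  · rw [hi, hi]
  · have h₃ : a (a i) ≠ a i := fun h' => hi (a.injective h')
    rw [← ne_eq, ← Fin.val_ne_iff] at hi
    rw [← Fin.val_ne_iff] at h₃
    omega

theorem isPGroup_treeGroup : IsPGroup 2 treeGroup := by
  intro t
  refine ⟨3, ?_⟩
  have h₁ : (t ^ 2).1.2.2 = 1 := by
    have : ∀ c : Equiv.Perm (Fin 2), c ^ 2 = 1 := by decide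
    exact this _
  have h₂ : (t ^ 2 * t ^ 2).1.2.1 = 1 := by
    rw [← sq]
    exact sq_eq_one_of_div_two (t ^ 2).1.2.1 fun j => by rw [(t ^ 2).2.2, h₁]; rfl
  have h₃ : leafHom ((t ^ 2 * t ^ 2) ^ 2) = 1 := by
    rw [map_pow]
    exact sq_eq_one_of_div_two _ fun i => by rw [leafHom_div_two, h₂]; rfl
  rw [map_eq_one_iff _ leafHom_injective] at h₃
  rw [← h₃]
  group

/-- The swap of the two subtrees at the root. -/
def rootSwap : treeGroup :=
  ⟨(swap 0 4 * swap 1 5 * swap 2 6 * swap 3 7, swap 0 2 * swap 1 3, swap 0 1), by decide +kernel,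
    by decide +kernel⟩

/-- The swap of the two subtrees below the first node at height two. -/
def nodeSwap₀ : treeGroup :=
  ⟨(swap 0 2 * swap 1 3, swap 0 1, 1), by decide +kernel, by decide +kernel⟩

/-- The swap of the two subtrees below the second node at height two. -/
def nodeSwap₁ : treeGroup :=
  ⟨(swap 4 6 * swap 5 7, swap 2 3, 1), by decide +kernel, by decide +kernel⟩

/-- The swap of the two leaves below a node. -/
def leafSwap (k : Fin 4) : treeGroup :=
  ⟨(swap ⟨2 * k, by omega⟩ ⟨2 * k + 1, by omega⟩, 1, 1), by revert k; decide +kernel,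
    fun _ => rfl⟩

/-- The tree automorphism with prescribed swaps at the seven inner nodes. -/
def ofBits (r a b c d e f : Bool) : treeGroup :=
  (if r then rootSwap else 1) * (if a then nodeSwap₀ else 1) * (if b then nodeSwap₁ else 1) *
    (if c then leafSwap 0 else 1) * (if d then leafSwap 1 else 1) *
    (if e then leafSwap 2 else 1) * (if f then leafSwap 3 else 1)

/-- The images of the leaves under `ofBits`. -/
def leafTable (r a b c d e f : Bool) : List ℕ :=
  let R := r.toNat
  let A := a.toNat
  let B := b.toNat
  [4 * R + 2 * A + c.toNat, 4 * R + 2 * A + (1 - c.toNat),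
    4 * R + 2 * (1 - A) + d.toNat, 4 * R + 2 * (1 - A) + (1 - d.toNat),
    4 * (1 - R) + 2 * B + e.toNat, 4 * (1 - R) + 2 * B + (1 - e.toNat),
    4 * (1 - R) + 2 * (1 - B) + f.toNat, 4 * (1 - R) + 2 * (1 - B) + (1 - f.toNat)]

theorem leafHom_ofBits : ∀ (r a b c d e f : Bool) (i : Fin 8),
    (leafHom (ofBits r a b c d e f) i : ℕ) = (leafTable r a b c d e f).getD i 0 := by
  decide +kernel

theorem treeSign_ofBits (r a b c d e f : Bool) :
    treeSign (ofBits r a b c d e f) =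
      if r ^^ a ^^ b ^^ c ^^ d ^^ e ^^ f then -1 else 1 := by
  have h₁ : treeSign rootSwap = -1 := by decide +kernel
  have h₂ : treeSign nodeSwap₀ = -1 := by decide +kernel
  have h₃ : treeSign nodeSwap₁ = -1 := by decide +kernel
  have h₄ : ∀ k, treeSign (leafSwap k) = -1 := by decide +kernel
  simp only [ofBits, map_mul, apply_ite treeSign, map_one, h₁, h₂, h₃, h₄]
  revert r a b c d e f
  decide

theorem leafTable_compare (r a b c d e f : Bool) :
    let l := leafTable r a b c d e f
    let p := fun i j => decide (l.getD j 0 < l.getD i 0)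
    p 0 4 = r ∧ p 0 2 = a ∧ p 4 6 = b ∧ p 0 1 = c ∧ p 2 3 = d ∧ p 4 5 = e ∧ p 6 7 = f := by
  revert r a b c d e f
  decide +kernel

theorem ofBits_injective : Function.Injective
    fun v : Bool × Bool × Bool × Bool × Bool × Bool × Bool =>
      ofBits v.1 v.2.1 v.2.2.1 v.2.2.2.1 v.2.2.2.2.1 v.2.2.2.2.2.1 v.2.2.2.2.2.2 := by
  rintro ⟨r, a, b, c, d, e, f⟩ ⟨r', a', b', c', d', e', f'⟩ h
  have hl : leafTable r a b c d e f = leafTable r' a' b' c' d' e' f' := by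
    refine List.ext_getElem rfl fun i hi hi' => ?_
    have h₁ := leafHom_ofBits r a b c d e f ⟨i, hi⟩
    have h₂ := leafHom_ofBits r' a' b' c' d' e' f' ⟨i, hi'⟩
    dsimp only at h
    rw [h, h₂] at h₁
    rwa [List.getD_eq_getElem _ _ hi, List.getD_eq_getElem _ _ hi', eq_comm] at h₁
  have h₁ := leafTable_compare r a b c d e f
  have h₂ := leafTable_compare r' a' b' c' d' e' f'
  simp only [hl] at h₁
  simp only [Prod.mk.injEq]
  grind

theorem card_sylow (Q : Sylow 2 (Equiv.Perm (Fin 8))) : Nat.card Q = 128 := by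
  rw [Sylow.card_eq_multiplicity, Nat.card_perm, Nat.card_fin,
    show Nat.factorial 8 = 2 ^ 7 * 315 by decide, Nat.factorization_mul (by norm_num) (by norm_num),
    Finsupp.add_apply, Nat.prime_two.factorization_pow, Finsupp.single_eq_same,
    Nat.factorization_eq_zero_of_not_dvd (n := 315) (by norm_num)]
  norm_num

theorem card_treeGroup_ge : 128 ≤ Nat.card treeGroup := by
  have h := Nat.card_le_card_of_injective _ ofBits_injective
  simpa using h

theorem exists_sylow_eq_range_leafHom :
    ∃ Q : Sylow 2 (Equiv.Perm (Fin 8)), (Q : Subgroup (Equiv.Perm (Fin 8))) = leafHom.range := by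
  obtain ⟨Q, hQ⟩ := (isPGroup_treeGroup.of_surjective leafHom.rangeRestrict
    leafHom.rangeRestrict_surjective).exists_le_sylow
  refine ⟨Q, (Subgroup.eq_of_le_of_card_ge hQ ?_).symm⟩
  rw [card_sylow, ← Nat.card_congr (MonoidHom.ofInjective leafHom_injective).toEquiv]
  exact card_treeGroup_ge

theorem card_treeGroup : Nat.card treeGroup = 128 := by
  obtain ⟨Q, hQ⟩ := exists_sylow_eq_range_leafHom
  rw [Nat.card_congr (MonoidHom.ofInjective leafHom_injective).toEquiv, ← hQ]
  exact card_sylow Q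

theorem exists_eq_ofBits (t : treeGroup) : ∃ r a b c d e f, t = ofBits r a b c d e f := by
  have h := (Nat.bijective_iff_injective_and_card _).mpr ⟨ofBits_injective, by
    rw [card_treeGroup]; simp⟩
  obtain ⟨⟨r, a, b, c, d, e, f⟩, hv⟩ := h.2 t
  exact ⟨r, a, b, c, d, e, f, hv.symm⟩

/-- Three conjugates of the Sylow subgroup with trivial intersection. -/
theorem exists_trivial_triple : ∃ x y : Equiv.Perm (Fin 8), ∀ t u v : treeGroup,
    leafHom t * x = x * leafHom u → leafHom t * y = y * leafHom v → t = 1 := by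
  refine ⟨swap 3 4 * swap 5 6, swap 1 2, fun t u v hu hv => ?_⟩
  have hu' : ∀ i, leafHom u i = swap 3 4 (swap 5 6 (leafHom t (swap 3 4 (swap 5 6 i)))) := by
    intro i
    have h := congrArg (fun z : Equiv.Perm (Fin 8) => z i) hu
    simp only [Equiv.Perm.mul_apply] at h ⊢
    rw [h]
    generalize leafHom u i = k
    revert k
    decide
  have hv' : ∀ i, leafHom v i = swap 1 2 (leafHom t (swap 1 2 i)) := by
    intro i
    have h := congrArg (fun z : Equiv.Perm (Fin 8) => z i) hv
    simp only [Equiv.Perm.mul_apply] at h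
    rw [h, Equiv.swap_apply_self]
  have hu₁ := @leafHom_div_two_congr u
  have hu₂ := @leafHom_div_four_congr u
  have hv₁ := @leafHom_div_two_congr v
  have hv₂ := @leafHom_div_four_congr v
  simp only [hu'] at hu₁ hu₂
  simp only [hv'] at hv₁ hv₂
  rw [← map_eq_one_iff _ leafHom_injective]
  obtain ⟨r, a, b, c, d, e, f, rfl⟩ := exists_eq_ofBits t
  clear hu hv hu' hv'
  revert r a b c d e f
  decide +kernel

/-- A test that the tree automorphism `u` with swaps `r, a, b, c, d, e, f` has an odd number of swaps
and that its conjugate `x⁻¹ u x` by the permutation `x` with list of values `l` is again a tree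
automorphism, whose swaps are read off from the order of its values. -/
def conjugates (l : List ℕ) (r a b c d e f : Bool) : Bool :=
  let u := leafTable r a b c d e f
  let ul := l.map fun n => u.getD n 0
  let w := ul.map fun n => l.idxOf n
  let p := fun i j => decide (w.getD j 0 < w.getD i 0)
  let v := leafTable (p 0 4) (p 0 2) (p 4 6) (p 0 1) (p 2 3) (p 4 5) (p 6 7)
  (r ^^ a ^^ b ^^ c ^^ d ^^ e ^^ f) && ul == v.map fun n => l.getD n 0

/-- Odd swap patterns, one of which passes the test `conjugates` for every normalized
permutation. -/
def oddBits : List (Bool × Bool × Bool × Bool × Bool × Bool × Bool) :=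
  [(false, false, true, true, true, false, false),
   (true, false, false, false, false, false, false),
   (true, true, true, false, true, true, false),
   (false, false, true, true, true, true, true),
   (false, false, false, false, false, false, true),
   (false, false, false, false, false, true, false),
   (false, false, false, false, true, false, false),
   (false, false, false, true, false, false, false),
   (true, false, false, true, true, true, true),
   (true, true, true, true, false, false, true),
   (true, false, false, false, true, false, true),
   (true, false, false, true, false, true, false),
   (true, true, true, false, false, false, false),
   (true, true, true, true, true, true, true)]

set_option synthInstance.maxSize 1000 in
set_option synthInstance.maxHeartbeats 200000 in
theorem exists_conjugates :
    ∀ x₀ x₁ : Fin 8, x₀ < x₁ → ∀ x₂, x₀ < x₂ ∧ x₂ ≠ x₁ → ∀ x₃, x₂ < x₃ ∧ x₃ ≠ x₁ →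
    ∀ x₄, x₀ < x₄ ∧ x₄ ≠ x₁ ∧ x₄ ≠ x₂ ∧ x₄ ≠ x₃ →
    ∀ x₅, x₄ < x₅ ∧ x₅ ≠ x₁ ∧ x₅ ≠ x₂ ∧ x₅ ≠ x₃ →
    ∀ x₆, x₄ < x₆ ∧ x₆ ≠ x₁ ∧ x₆ ≠ x₂ ∧ x₆ ≠ x₃ ∧ x₆ ≠ x₅ →
    ∀ x₇, x₆ < x₇ ∧ x₇ ≠ x₁ ∧ x₇ ≠ x₂ ∧ x₇ ≠ x₃ ∧ x₇ ≠ x₅ →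
    (oddBits.any fun v => conjugates [x₀, x₁, x₂, x₃, x₄, x₅, x₆, x₇]
      v.1 v.2.1 v.2.2.1 v.2.2.2.1 v.2.2.2.2.1 v.2.2.2.2.2.1 v.2.2.2.2.2.2) = true := by
  decide +kernel

/-- The values of a function, read as the digits of a number in base eight. -/
def ofValues (x : Fin 8 → Fin 8) : ℕ :=
  x 0 * 8 ^ 7 + x 1 * 8 ^ 6 + x 2 * 8 ^ 5 + x 3 * 8 ^ 4 + x 4 * 8 ^ 3 + x 5 * 8 ^ 2 + x 6 * 8 + x 7

/-- A permutation whose `ofValues` is least among its products with tree automorphisms is ordered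
along each swap of subtrees. -/
theorem lt_of_ofValues_le (x : Equiv.Perm (Fin 8))
    (h : ∀ t : treeGroup, ofValues x ≤ ofValues (x ∘ leafHom t)) :
    x 0 < x 1 ∧ x 2 < x 3 ∧ x 4 < x 5 ∧ x 6 < x 7 ∧ x 0 < x 2 ∧ x 4 < x 6 ∧ x 0 < x 4 := by
  have hv : ∀ (t : treeGroup) (w : Fin 8 → Fin 8), (∀ i, leafHom t i = w i) →
      ofValues x ≤ ofValues (x ∘ w) := by
    intro t w htw
    rw [← funext htw]
    exact h t
  have h₁ := hv (leafSwap 0) ![1, 0, 2, 3, 4, 5, 6, 7] (by decide +kernel)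
  have h₂ := hv (leafSwap 1) ![0, 1, 3, 2, 4, 5, 6, 7] (by decide +kernel)
  have h₃ := hv (leafSwap 2) ![0, 1, 2, 3, 5, 4, 6, 7] (by decide +kernel)
  have h₄ := hv (leafSwap 3) ![0, 1, 2, 3, 4, 5, 7, 6] (by decide +kernel)
  have h₅ := hv nodeSwap₀ ![2, 3, 0, 1, 4, 5, 6, 7] (by decide +kernel)
  have h₆ := hv nodeSwap₁ ![0, 1, 2, 3, 6, 7, 4, 5] (by decide +kernel)
  have h₇ := hv rootSwap ![4, 5, 6, 7, 0, 1, 2, 3] (by decide +kernel)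
  have hne : ∀ i j : Fin 8, i ≠ j → (x i : ℕ) ≠ x j :=
    fun i j hij h => hij (x.injective (Fin.ext h))
  have n₁ := hne 0 1 (by decide)
  have n₂ := hne 2 3 (by decide)
  have n₃ := hne 4 5 (by decide)
  have n₄ := hne 6 7 (by decide)
  have n₅ := hne 0 2 (by decide)
  have n₆ := hne 4 6 (by decide)
  have n₇ := hne 0 4 (by decide)
  simp [ofValues] at h₁ h₂ h₃ h₄ h₅ h₆ h₇
  simp only [Fin.lt_def]
  omega

/-- Any two conjugates of the Sylow subgroup share an element of tree sign `-1`. -/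
theorem exists_common_odd (x : Equiv.Perm (Fin 8)) :
    ∃ u v : treeGroup, leafHom u * x = x * leafHom v ∧ treeSign u = -1 := by
  obtain ⟨t, ht⟩ := Finite.exists_min fun t : treeGroup => ofValues (x ∘ leafHom t)
  set y := x * leafHom t with hy
  obtain ⟨h₀₁, h₂₃, h₄₅, h₆₇, h₀₂, h₄₆, h₀₄⟩ := lt_of_ofValues_le y fun s => by
    simpa only [hy, map_mul, Equiv.Perm.coe_mul, Function.comp_assoc] using ht (t * s)
  have hne : ∀ i j : Fin 8, i ≠ j → y i ≠ y j := fun i j hij h => hij (y.injective h)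
  have key := exists_conjugates (y 0) (y 1) h₀₁ (y 2) ⟨h₀₂, by simp [hne]⟩ (y 3)
    ⟨h₂₃, by simp [hne]⟩ (y 4) ⟨h₀₄, by simp [hne]⟩ (y 5) ⟨h₄₅, by simp [hne]⟩ (y 6)
    ⟨h₄₆, by simp [hne]⟩ (y 7) ⟨h₆₇, by simp [hne]⟩
  have hl : [(y 0 : ℕ), y 1, y 2, y 3, y 4, y 5, y 6, y 7] = List.ofFn fun i => (y i : ℕ) := rfl
  rw [hl, List.any_eq_true] at key
  obtain ⟨⟨r, a, b, c, d, e, f⟩, -, hc⟩ := key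
  simp only [conjugates, Bool.and_eq_true, beq_iff_eq] at hc
  obtain ⟨hodd, hc⟩ := hc
  obtain ⟨r', a', b', c', d', e', f', hc⟩ : ∃ r' a' b' c' d' e' f',
      (List.ofFn fun i => (y i : ℕ)).map (fun n => (leafTable r a b c d e f).getD n 0) =
        (leafTable r' a' b' c' d' e' f').map
          fun n => (List.ofFn fun i => (y i : ℕ)).getD n 0 :=
    ⟨_, _, _, _, _, _, _, hc⟩
  have hy' : leafHom (ofBits r a b c d e f) * y = y * leafHom (ofBits r' a' b' c' d' e' f') := by
    ext i
    have hi : (i : ℕ) < (leafTable r' a' b' c' d' e' f').length := i.2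
    have h := congrArg (fun l => l[(i : ℕ)]?) hc
    have hw := leafHom_ofBits r' a' b' c' d' e' f' i
    rw [List.getD_eq_getElem _ _ hi] at hw
    simp only [List.getElem?_map, List.getElem?_eq_getElem hi, ← hw, List.getElem?_ofFn, i.2,
      List.getD_eq_getElem?_getD, Fin.is_lt, dite_true, Option.map_some, Option.getD_some,
      Option.some.injEq] at h
    rw [Equiv.Perm.mul_apply _ y, leafHom_ofBits, List.getD_eq_getElem?_getD]
    exact h
  refine ⟨ofBits r a b c d e f, t * ofBits r' a' b' c' d' e' f' * t⁻¹, ?_, ?_⟩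
  · rw [map_mul, map_mul, ← mul_assoc, ← mul_assoc, ← hy, ← hy', hy, map_inv]
    group
  · rw [treeSign_ofBits, if_pos hodd]

/-- Let `P` be a Sylow 2-subgroup of `G = S₈`. Then (i) `P` meets each of
its conjugates nontrivially; (ii) some two conjugates of `P` meet `P` trivially (so
`b(G,P) = 3`); and (iii) some two irreducible complex characters of `P` are not linked
over `G` (so `K(G,P)` is not complete and `d_G(P) > 3`). -/
theorem sylow2_S8 (P : Sylow 2 (Equiv.Perm (Fin 8))) :
    (∀ x : Equiv.Perm (Fin 8), (P : Subgroup (Equiv.Perm (Fin 8))) ⊓ conjSub x ↑P ≠ ⊥) ∧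
    (∃ x y : Equiv.Perm (Fin 8),
      (P : Subgroup (Equiv.Perm (Fin 8))) ⊓ conjSub x ↑P ⊓ conjSub y ↑P = ⊥) ∧
    (∃ α β : ↥(P : Subgroup (Equiv.Perm (Fin 8))) → ℂ,
      IsIrrChar ↥(P : Subgroup (Equiv.Perm (Fin 8))) α ∧
      IsIrrChar ↥(P : Subgroup (Equiv.Perm (Fin 8))) β ∧
      ¬ Linked (P : Subgroup (Equiv.Perm (Fin 8))) α β) := by
  obtain ⟨Q, hQ⟩ := exists_sylow_eq_range_leafHom
  obtain ⟨g, hg⟩ := MulAction.exists_smul_eq (Equiv.Perm (Fin 8)) Q P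
  let ψ : treeGroup →* Equiv.Perm (Fin 8) := (MulAut.conj g).toMonoidHom.comp leafHom
  have hψ : ∀ t, ψ t = g * leafHom t * g⁻¹ := fun t => rfl
  have hψi : Function.Injective ψ := (MulAut.conj g).injective.comp leafHom_injective
  have hP : (P : Subgroup (Equiv.Perm (Fin 8))) = ψ.range := by
    rw [← hg, Sylow.coe_subgroup_smul, hQ, MonoidHom.range_comp]
    rfl
  have hodd : ∀ x, ∃ u v : treeGroup, ψ u * x = x * ψ v ∧ treeSign u = -1 := by
    intro x
    obtain ⟨u, v, huv, hu⟩ := exists_common_odd (g⁻¹ * x * g)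
    refine ⟨u, v, ?_, hu⟩
    rw [hψ, hψ]
    calc g * leafHom u * g⁻¹ * x = g * (leafHom u * (g⁻¹ * x * g)) * g⁻¹ := by group
      _ = x * (g * leafHom v * g⁻¹) := by rw [huv]; group
  have hconj : ∀ x z, z ∈ conjSub x ψ.range ↔ ∃ v, z * x = x * ψ v := by
    intro x z
    simp only [conjSub, Subgroup.mem_map, MonoidHom.mem_range, exists_exists_eq_and,
      MulEquiv.coe_toMonoidHom, MulAut.conj_apply, mul_inv_eq_iff_eq_mul]
    exact exists_congr fun v => eq_comm
  rw [hP]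
  refine ⟨fun x hx => ?_, ?_, ?_⟩
  · obtain ⟨u, v, huv, hu⟩ := hodd x
    have hmem : ψ u ∈ ψ.range ⊓ conjSub x ψ.range := ⟨⟨u, rfl⟩, (hconj _ _).mpr ⟨v, huv⟩⟩
    rw [hx, Subgroup.mem_bot, map_eq_one_iff _ hψi] at hmem
    rw [hmem, map_one] at hu
    exact absurd hu (by decide)
  · obtain ⟨x, y, hxy⟩ := exists_trivial_triple
    refine ⟨g * x * g⁻¹, g * y * g⁻¹, (Subgroup.eq_bot_iff_forall _).mpr ?_⟩
    rintro _ ⟨⟨⟨t, rfl⟩, hx⟩, hy⟩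
    have cancel : ∀ (w : Equiv.Perm (Fin 8)) (u : treeGroup),
        ψ t * (g * w * g⁻¹) = g * w * g⁻¹ * ψ u → leafHom t * w = w * leafHom u := by
      intro w u h
      rw [hψ, hψ] at h
      calc leafHom t * w = g⁻¹ * (g * leafHom t * g⁻¹ * (g * w * g⁻¹)) * g := by group
        _ = w * leafHom u := by rw [h]; group
    obtain ⟨u, hu⟩ := (hconj _ _).mp hx
    obtain ⟨v, hv⟩ := (hconj _ _).mp hy
    rw [hxy t u v (cancel x u hu) (cancel y v hv), map_one]
  · let φ : ψ.range →* ℤˣ := treeSign.comp (MonoidHom.ofInjective hψi).symm.toMonoidHom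
    refine ⟨fun _ => 1, fun h => ((φ h : ℤ) : ℂ), by simpa using isIrrChar_of_hom 1,
      isIrrChar_of_hom φ, not_linked_one_of_hom _ φ fun x => ?_⟩
    obtain ⟨u, v, huv, hu⟩ := hodd x
    refine ⟨MonoidHom.ofInjective hψi u, MonoidHom.ofInjective hψi v, huv, ?_⟩
    simpa [φ] using hu
end
end

section
/- There exists a finite group G of order 128 together with a core-free elementary abelian subgroup H of order 8 such that: (i) any two irreducible complex characters of H are linked over G (so the Külshammer graph K(G,H) is complete and d_G(H) = 3); (ii) for all x, y ∈ G the intersection H ∩ xHx⁻¹ ∩ yHy⁻¹ is nontrivial; and (iii) there exist x, y, z ∈ G with H ∩ xHx⁻¹ ∩ yHy⁻¹ ∩ zHz⁻¹ trivial. In particular, the base size satisfies b(G,H) = 4 even though the depth is 3, answering Question 5.1 of al Janabi–Harris–Hajarnavis in the negative. -/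
noncomputable section

open Matrix

/-- The extraspecial group `2₊^{1+6}`, as the Heisenberg group of rank three over `𝔽₂`. -/
@[ext]
structure Heisenberg where
  /-- The translation part. -/
  x : Fin 3 → ZMod 2
  /-- The modulation part. -/
  y : Fin 3 → ZMod 2
  /-- The central part. -/
  z : ZMod 2

namespace Heisenberg

/-- The coordinates of an element of the Heisenberg group. -/
def coordEquiv : Heisenberg ≃ (Fin 3 → ZMod 2) × (Fin 3 → ZMod 2) × ZMod 2 where
  toFun g := (g.x, g.y, g.z)
  invFun p := ⟨p.1, p.2.1, p.2.2⟩
  left_inv _ := rfl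
  right_inv _ := rfl

instance : Fintype Heisenberg := Fintype.ofEquiv _ coordEquiv.symm

theorem card_eq : Fintype.card Heisenberg = 128 := by
  simp [Fintype.card_congr coordEquiv, ZMod.card]

instance : Mul Heisenberg := ⟨fun g h => ⟨g.x + h.x, g.y + h.y, g.z + h.z + g.x ⬝ᵥ h.y⟩⟩
instance : One Heisenberg := ⟨⟨0, 0, 0⟩⟩
instance : Inv Heisenberg := ⟨fun g => ⟨-g.x, -g.y, -g.z + g.x ⬝ᵥ g.y⟩⟩

@[simp] theorem mul_x (g h : Heisenberg) : (g * h).x = g.x + h.x := rfl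
@[simp] theorem mul_y (g h : Heisenberg) : (g * h).y = g.y + h.y := rfl
@[simp] theorem mul_z (g h : Heisenberg) : (g * h).z = g.z + h.z + g.x ⬝ᵥ h.y := rfl
@[simp] theorem one_x : (1 : Heisenberg).x = 0 := rfl
@[simp] theorem one_y : (1 : Heisenberg).y = 0 := rfl
@[simp] theorem one_z : (1 : Heisenberg).z = 0 := rfl
@[simp] theorem inv_x (g : Heisenberg) : g⁻¹.x = -g.x := rfl
@[simp] theorem inv_y (g : Heisenberg) : g⁻¹.y = -g.y := rfl
@[simp] theorem inv_z (g : Heisenberg) : g⁻¹.z = -g.z + g.x ⬝ᵥ g.y := rfl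

instance : Group Heisenberg :=
  Group.ofLeftAxioms
    (fun g h k => by
      ext1
      · simp [add_assoc]
      · simp [add_assoc]
      · simp only [mul_x, mul_y, mul_z, add_dotProduct, dotProduct_add]; ring)
    (fun g => by ext1 <;> simp)
    (fun g => by
      ext1
      · simp
      · simp
      · simp only [inv_x, mul_z, inv_z, one_z, neg_dotProduct]; ring)

/-- The subgroup of translations. -/
def translations : Subgroup Heisenberg where
  carrier := {g | g.y = 0 ∧ g.z = 0}
  mul_mem' := by
    rintro g h ⟨hg, hg'⟩ ⟨hh, hh'⟩
    simp [hg, hg', hh, hh']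
  one_mem' := by simp
  inv_mem' := by
    rintro g ⟨hg, hg'⟩
    simp [hg, hg']

theorem mem_translations {g : Heisenberg} : g ∈ translations ↔ g.y = 0 ∧ g.z = 0 := Iff.rfl

theorem mem_conjSub_translations {g h : Heisenberg} :
    h ∈ conjSub g translations ↔ h.y = 0 ∧ h.z = h.x ⬝ᵥ g.y := by
  have key : h ∈ conjSub g translations ↔ g⁻¹ * h * g ∈ translations := by
    constructor
    · rintro ⟨k, hk, rfl⟩
      simpa [mul_assoc] using hk
    · exact fun hk => ⟨_, hk, by simp [mul_assoc]⟩
  rw [key, mem_translations]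
  simp only [mul_x, mul_y, mul_z, inv_x, inv_y, inv_z, add_dotProduct, neg_dotProduct]
  have hy : -g.y + h.y + g.y = h.y := by abel
  rw [hy]
  refine and_congr_right fun h0 => ?_
  rw [h0, dotProduct_zero, ← sub_eq_zero (a := h.z), CharTwo.sub_eq_add]
  ring_nf

theorem translations_eq_one {h : Heisenberg} (hh : h ∈ translations) (hx : h.x = 0) : h = 1 :=
  Heisenberg.ext hx hh.1 hh.2

theorem normalCore_translations : translations.normalCore = ⊥ := by
  rw [eq_bot_iff]
  intro h hh
  have hH := Subgroup.normalCore_le _ hh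
  refine translations_eq_one hH ((dotProduct_eq_zero_iff).1 fun b => ?_)
  have hb := hh ⟨0, b, 0⟩
  simpa [mem_translations, hH.1, hH.2] using hb.2

/-- Translations are parametrised by the vectors of `𝔽₂³`. -/
def translationsEquiv : translations ≃ (Fin 3 → ZMod 2) where
  toFun h := h.1.x
  invFun a := ⟨⟨a, 0, 0⟩, rfl, rfl⟩
  left_inv h := Subtype.ext (Heisenberg.ext rfl h.2.1.symm h.2.2.symm)
  right_inv _ := rfl

theorem card_translations : Nat.card translations = 8 := by
  rw [Nat.card_congr translationsEquiv]
  simp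

theorem translations_mul_self (h : translations) : h * h = 1 := by
  refine Subtype.ext (translations_eq_one (h * h).2 ?_)
  simp [CharTwo.add_self_eq_zero]

theorem exists_ne_zero_dotProduct_eq_zero :
    ∀ b c : Fin 3 → ZMod 2, ∃ a ≠ 0, a ⬝ᵥ b = 0 ∧ a ⬝ᵥ c = 0 := by
  decide +kernel

theorem inf_conjSub_conjSub_ne_bot (g k : Heisenberg) :
    translations ⊓ conjSub g translations ⊓ conjSub k translations ≠ ⊥ := by
  obtain ⟨a, ha, hg, hk⟩ := exists_ne_zero_dotProduct_eq_zero g.y k.y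
  refine Subgroup.ne_bot_iff_exists_ne_one.2 ⟨⟨⟨a, 0, 0⟩, ?_⟩, ?_⟩
  · simp [mem_translations, mem_conjSub_translations, hg, hk]
  · exact fun h => ha (congrArg x (congrArg Subtype.val h))

theorem exists_inf_conjSub_eq_bot :
    ∃ g k l : Heisenberg, translations ⊓ conjSub g translations ⊓ conjSub k translations ⊓
      conjSub l translations = ⊥ := by
  refine ⟨⟨0, Pi.single 0 1, 0⟩, ⟨0, Pi.single 1 1, 0⟩, ⟨0, Pi.single 2 1, 0⟩, ?_⟩
  rw [eq_bot_iff]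
  rintro h ⟨⟨⟨h0, h1⟩, h2⟩, h3⟩
  refine translations_eq_one h0 ?_
  have e1 := (mem_conjSub_translations.1 h1).2
  have e2 := (mem_conjSub_translations.1 h2).2
  have e3 := (mem_conjSub_translations.1 h3).2
  simp only [h0.2, dotProduct_single, mul_one] at e1 e2 e3
  ext i
  fin_cases i
  · exact e1.symm
  · exact e2.symm
  · exact e3.symm

/-- The nontrivial additive character of `𝔽₂`. -/
def sign (c : ZMod 2) : ℤ := if c = 0 then 1 else -1

theorem sign_add : ∀ c d : ZMod 2, sign (c + d) = sign c * sign d := by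
  decide

theorem sum_sign_add_dotProduct : ∀ (b : Fin 3 → ZMod 2) (c : ZMod 2),
    ∑ t : Fin 3 → ZMod 2, sign (c + t ⬝ᵥ b) = if b = 0 then 8 * sign c else 0 := by
  decide +kernel

/-- The Schrödinger representation on functions on `𝔽₂³`. -/
def schrodinger : Representation ℂ Heisenberg ((Fin 3 → ZMod 2) → ℂ) where
  toFun g :=
    { toFun := fun f t => (sign (g.z + t ⬝ᵥ g.y) : ℂ) * f (t + g.x)
      map_add' := fun f f' => by ext t; simp [mul_add]
      map_smul' := fun r f => by ext t; simp [mul_left_comm] }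
  map_one' := by
    ext f t
    simp [sign]
  map_mul' g h := by
    refine LinearMap.ext fun f => funext fun t => ?_
    change (sign _ : ℂ) * f _ = (sign _ : ℂ) * ((sign _ : ℂ) * f _)
    rw [← mul_assoc, ← Int.cast_mul, ← sign_add]
    simp only [mul_x, mul_y, mul_z, add_dotProduct, dotProduct_add, add_assoc]
    congr 3
    ring

theorem schrodinger_apply (g : Heisenberg) (f : (Fin 3 → ZMod 2) → ℂ) (t : Fin 3 → ZMod 2) :
    schrodinger g f t = (sign (g.z + t ⬝ᵥ g.y) : ℂ) * f (t + g.x) := rfl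

theorem schrodinger_character (g : Heisenberg) :
    (FDRep.of schrodinger).character g =
      if g.x = 0 ∧ g.y = 0 then 8 * (sign g.z : ℂ) else 0 := by
  change LinearMap.trace ℂ ((Fin 3 → ZMod 2) → ℂ) (schrodinger g) = _
  rw [LinearMap.trace_eq_matrix_trace ℂ (Pi.basisFun ℂ (Fin 3 → ZMod 2)), Matrix.trace]
  simp only [Matrix.diag_apply, LinearMap.toMatrix_apply, Pi.basisFun_repr, Pi.basisFun_apply,
    schrodinger_apply]
  by_cases hx : g.x = 0
  · have := sum_sign_add_dotProduct g.y g.z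
    simp only [hx, add_zero, Pi.single_eq_same, mul_one, true_and]
    exact_mod_cast this
  · simp [hx]

theorem schrodinger_simple : CategoryTheory.Simple (FDRep.of schrodinger) := by
  rw [FDRep.simple_iff_char_is_norm_one, ← Equiv.sum_comp coordEquiv.symm,
    Nat.card_eq_fintype_card, card_eq]
  have hz : (Finset.univ : Finset (ZMod 2)) = {0, 1} := rfl
  simp only [schrodinger_character, Fintype.sum_prod_type, coordEquiv, Equiv.coe_fn_symm_mk, inv_x,
    inv_y, inv_z, neg_eq_zero, ite_and]
  simp [hz, sign]
  norm_num

theorem linked_translations {α β : translations → ℂ} (hα : α 1 ≠ 0) (hβ : β 1 ≠ 0) :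
    Linked translations α β := by
  have key (γ : translations → ℂ) (hγ : γ 1 ≠ 0) :
      charInner translations
        (resChar translations (FDRep.of schrodinger).character) γ ≠ 0 := by
    rw [charInner, card_translations, finsum_eq_single _ 1]
    · simpa [resChar, schrodinger_character, sign] using hγ
    · intro h hh
      have hx : h.1.x ≠ 0 := fun hx => hh (Subtype.ext (translations_eq_one h.2 hx))
      simp [resChar, schrodinger_character, hx]
  exact ⟨_, ⟨_, schrodinger_simple, rfl⟩, key α hα, key β hβ⟩

end Heisenberg

theorem IsIrrChar.apply_one_ne_zero {H : Type} [Group H] [Finite H] {χ : H → ℂ}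
    (hχ : IsIrrChar H χ) : χ 1 ≠ 0 := by
  obtain ⟨V, hV, rfl⟩ := hχ
  have := Fintype.ofFinite H
  intro h0
  rw [FDRep.char_one, Nat.cast_eq_zero, Module.finrank_zero_iff] at h0
  have hchar (g : H) : V.character g = 0 := by
    rw [FDRep.character, Subsingleton.elim (V.ρ g) 0, map_zero]
  have hsum := (FDRep.simple_iff_char_is_norm_one V).1 hV
  simp [hchar, eq_comm] at hsum

/-- There is a group `G` of order 128 with a core-free elementary abelian
subgroup `H` of order 8 such that the Külshammer graph `K(G,H)` is complete (depth 3),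
yet no two conjugates of `H` intersect `H` trivially while some three do: `b(G,H) = 4`. -/
theorem depth_three_base_four :
    ∃ (G : Type) (_ : Group G) (_ : Fintype G), Fintype.card G = 128 ∧
      ∃ H : Subgroup G, H.normalCore = ⊥ ∧ Nat.card ↥H = 8 ∧ (∀ h : ↥H, h * h = 1) ∧
        (∀ α β : ↥H → ℂ, IsIrrChar ↥H α → IsIrrChar ↥H β → Linked H α β) ∧
        (∀ x y : G, H ⊓ conjSub x H ⊓ conjSub y H ≠ ⊥) ∧
        (∃ x y z : G, H ⊓ conjSub x H ⊓ conjSub y H ⊓ conjSub z H = ⊥) := by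
  exact ⟨Heisenberg, inferInstance, inferInstance, Heisenberg.card_eq, Heisenberg.translations,
    Heisenberg.normalCore_translations, Heisenberg.card_translations,
    Heisenberg.translations_mul_self,
    fun _ _ hα hβ => Heisenberg.linked_translations hα.apply_one_ne_zero hβ.apply_one_ne_zero,
    Heisenberg.inf_conjSub_conjSub_ne_bot, Heisenberg.exists_inf_conjSub_eq_bot⟩
end
end

section
/- Let n ≥ 7 and let G = Sₙ be the symmetric group on {1,…,n}. Let H be a core-free subgroup of G which is not the stabilizer of a point of {1,…,n}. Then there exist g₁, …, g_{n−2} ∈ G with ⋂_{i=1}^{n−2} g_i H g_i⁻¹ trivial; that is, the base size satisfies b(G,H) ≤ n − 2. -/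
noncomputable section

open Equiv MulAction
open scoped Pointwise

section BaseSize

variable {α : Type*}

/-- `H` preserves only the two trivial equivalence relations. -/
def PreservesOnlyTrivial (H : Subgroup (Perm α)) : Prop :=
  ∀ r : Setoid α, (∀ h ∈ H, ∀ u v, r u v → r (h u) (h v)) →
    (∀ u v, r u v → u = v) ∨ ∀ u v, r u v

lemma preservesOnlyTrivial_of_isPreprimitive {H : Subgroup (Perm α)} (hH : IsPreprimitive H α) :
    PreservesOnlyTrivial H := by
  intro r hr
  have hblock : ∀ a, IsBlock H {y | r a y} := by
    intro a
    rw [isBlock_iff_smul_eq_or_disjoint]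
    intro g
    have himg : g • {y | r a y} = {y | r ((g : Perm α) a) y} := by
      ext y
      rw [Set.mem_smul_set_iff_inv_smul_mem]
      constructor
      · intro h
        have := hr g g.2 _ _ h
        simpa [Subgroup.smul_def] using this
      · intro h
        have := hr (g : Perm α)⁻¹ (H.inv_mem g.2) _ _ h
        simpa [Subgroup.smul_def] using this
    rw [himg]
    by_cases hra : r a ((g : Perm α) a)
    · left
      ext y
      exact ⟨fun h => r.trans hra h, fun h => r.trans (r.symm hra) h⟩
    · right
      rw [Set.disjoint_left]
      intro y h1 h2
      exact hra (r.trans h2 (r.symm h1))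
  by_cases hall : ∃ a, {y | r a y} = Set.univ
  · obtain ⟨a, ha⟩ := hall
    right
    intro u v
    have hu : u ∈ {y | r a y} := ha ▸ Set.mem_univ u
    have hv : v ∈ {y | r a y} := ha ▸ Set.mem_univ v
    exact r.trans (r.symm hu) hv
  · left
    intro u v huv
    have := (hblock u).subsingleton_or_eq_univ.resolve_right fun e => hall ⟨u, e⟩
    exact this (r.refl u) huv

lemma exists_invariant_setoid {H : Subgroup (Perm α)} (ht : IsPretransitive H α)
    (hH : ¬ IsPreprimitive H α) :
    ∃ r : Setoid α, (∀ h ∈ H, ∀ u v, r (h u) (h v) ↔ r u v) ∧ (∃ u v, u ≠ v ∧ r u v) ∧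
      ∃ u v, ¬ r u v := by
  obtain ⟨B, hB, hBt⟩ : ∃ B : Set α, IsBlock H B ∧ ¬ IsTrivialBlock B := by
    by_contra! hc
    exact hH ⟨fun {B} hB => hc B hB⟩
  rw [IsTrivialBlock, not_or] at hBt
  obtain ⟨hsub, huniv⟩ := hBt
  rw [Set.not_subsingleton_iff] at hsub
  obtain ⟨b, hb, b', hb', hbb⟩ := hsub
  obtain ⟨c, hc⟩ := (Set.ne_univ_iff_exists_notMem B).1 huniv
  have hsame : ∀ g₁ g₂ : H, ∀ y, y ∈ g₁ • B → y ∈ g₂ • B → g₁ • B = g₂ • B := by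
    intro g₁ g₂ y h1 h2
    exact isBlock_iff_smul_eq_smul_of_nonempty.1 hB ⟨y, h1, h2⟩
  have hcover : ∀ y, ∃ g : H, y ∈ g • B := by
    intro y
    obtain ⟨g, hg⟩ := exists_smul_eq H b y
    exact ⟨g, b, hb, hg⟩
  have hone : b ∈ (1 : H) • B := by simpa using hb
  refine ⟨⟨fun u v => ∃ g : H, u ∈ g • B ∧ v ∈ g • B, ?_, ?_, ?_⟩, ?_, ?_, ?_⟩
  · intro u
    obtain ⟨g, hg⟩ := hcover u
    exact ⟨g, hg, hg⟩
  · rintro u v ⟨g, h1, h2⟩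
    exact ⟨g, h2, h1⟩
  · rintro u v w ⟨g, h1, h2⟩ ⟨g', h3, h4⟩
    exact ⟨g, h1, hsame g g' v h2 h3 ▸ h4⟩
  · intro h hh u v
    constructor
    · rintro ⟨g, h1, h2⟩
      refine ⟨⟨h, hh⟩⁻¹ * g, ?_, ?_⟩ <;> rw [mul_smul, Set.mem_inv_smul_set_iff] <;> assumption
    · rintro ⟨g, h1, h2⟩
      refine ⟨⟨h, hh⟩ * g, ?_, ?_⟩ <;> rw [mul_smul]
      · exact Set.smul_mem_smul_set (a := (⟨h, hh⟩ : H)) h1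
      · exact Set.smul_mem_smul_set (a := (⟨h, hh⟩ : H)) h2
  · exact ⟨b, b', hbb, 1, hone, by simpa using hb'⟩
  · refine ⟨b, c, ?_⟩
    rintro ⟨g, h1, h2⟩
    have := hsame g 1 b h1 hone
    rw [this] at h2
    exact hc (by simpa using h2)

variable [DecidableEq α]

/-- At most `k` conjugates of `H` are needed to obtain a trivial intersection. -/
def HasBaseLE (H : Subgroup (Perm α)) (k : ℕ) : Prop :=
  ∃ T : Finset (Perm α), T.card ≤ k ∧ ∀ h, (∀ g ∈ T, g⁻¹ * h * g ∈ H) → h = 1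

/-- Every element of `H` whose conjugate by `swap x y` lies in `H` preserves `{x, y}`. -/
def PinsPair (H : Subgroup (Perm α)) (x y : α) : Prop :=
  ∀ h ∈ H, swap x y * h * swap x y ∈ H → (h x = x ∨ h x = y) ∧ (h y = x ∨ h y = y)

lemma PinsPair.symm {H : Subgroup (Perm α)} {x y : α} (h : PinsPair H x y) : PinsPair H y x := by
  intro g hg hg'
  rw [swap_comm] at hg'
  have := h g hg hg'
  tauto

/-- A permutation fixing everything outside `{p, q}` is trivial or the transposition `swap p q`. -/
lemma eq_one_or_eq_swap {p q : α} (h : Perm α) (hfix : ∀ z, z ≠ p → z ≠ q → h z = z) :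
    h = 1 ∨ h = swap p q := by
  have hp : h p = p ∨ h p = q := by
    by_contra! hc
    exact hc.1 (h.injective (hfix _ hc.1 hc.2))
  have hq : h q = p ∨ h q = q := by
    by_contra! hc
    exact hc.2 (h.injective (hfix _ hc.1 hc.2))
  have hinj : h p = h q → p = q := fun e => h.injective e
  by_cases hp' : h p = p
  · left
    ext z
    by_cases hzp : z = p
    · subst hzp; simpa using hp'
    by_cases hzq : z = q
    · subst hzq
      rcases hq with hq | hq
      · exact absurd (hinj (hp'.trans hq.symm)).symm hzp
      · simpa using hq
    · simpa using hfix z hzp hzq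
  · right
    have hp'' : h p = q := hp.resolve_left hp'
    ext z
    by_cases hzp : z = p
    · subst hzp; simpa using hp''
    by_cases hzq : z = q
    · subst hzq
      rcases hq with hq | hq
      · simpa using hq
      · exact absurd (hinj (hp''.trans hq.symm)).symm hzp
    · simpa [swap_apply_of_ne_of_ne hzp hzq] using hfix z hzp hzq

variable [Fintype α]

lemma card_insert_image_le {f : α → Perm α} {g : Perm α} (s : Finset α) :
    (insert g ((sᶜ).image f)).card ≤ Fintype.card α - s.card + 1 := by
  refine (Finset.card_insert_le _ _).trans ?_
  have := Finset.card_image_le (s := sᶜ) (f := f)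
  rw [Finset.card_compl] at this
  omega

/-- A double star of pinned pairs with centres `x`, `y` which misses only `p`, `q`. -/
lemma hasBaseLE_of_pinsPair {H : Subgroup (Perm α)} {p q x y w : α}
    (hpq : p ≠ q) (hpx : p ≠ x) (hqx : q ≠ x) (hxy : x ≠ y) (hyp : y ≠ p) (hyq : y ≠ q)
    (hw : w ≠ p ∧ w ≠ q ∧ w ≠ x ∧ w ≠ y)
    (hswap : swap p q ∉ H) (hpin : PinsPair H x y)
    (hstar : ∀ z, z ≠ p → z ≠ q → z ≠ x → z ≠ y → PinsPair H z x ∨ PinsPair H z y) :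
    HasBaseLE H (Fintype.card α - 2) := by
  classical
  let c : α → α := fun z => if z = y then x else if PinsPair H z x then x else y
  have hcard : ({p, q, x} : Finset α).card = 3 := by
    rw [Finset.card_eq_three]; exact ⟨p, q, x, hpq, hpx, hqx, rfl⟩
  have hle : 3 ≤ Fintype.card α := hcard ▸ Finset.card_le_univ _
  refine ⟨insert 1 (({p, q, x} : Finset α)ᶜ.image fun z => swap z (c z)), ?_, fun h hT => ?_⟩
  · refine (card_insert_image_le _).trans ?_
    omega
  have hH : h ∈ H := by simpa using hT 1 (Finset.mem_insert_self _ _)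
  have hconj : ∀ z, z ≠ p → z ≠ q → z ≠ x → swap z (c z) * h * swap z (c z) ∈ H := by
    intro z h1 h2 h3
    simpa using hT (swap z (c z))
      (Finset.mem_insert_of_mem (Finset.mem_image_of_mem _ (by simp [h1, h2, h3])))
  have hedge : ∀ z, z ≠ p → z ≠ q → z ≠ x → PinsPair H z (c z) := by
    intro z h1 h2 h3
    by_cases hz : z = y
    · subst hz; simpa [c] using hpin.symm
    · by_cases hzx : PinsPair H z x
      · simp [c, hz, hzx]
      · simpa [c, hz, hzx] using (hstar z h1 h2 h3 hz).resolve_left hzx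
  have hkeep : ∀ z, z ≠ p → z ≠ q → z ≠ x →
      (h z = z ∨ h z = c z) ∧ (h (c z) = z ∨ h (c z) = c z) :=
    fun z h1 h2 h3 => hedge z h1 h2 h3 h hH (hconj z h1 h2 h3)
  have hc : ∀ z, c z = x ∨ c z = y := by
    intro z; simp only [c]; split_ifs <;> simp
  have hcy : c y = x := by simp [c]
  obtain ⟨hw1, hw2, hw3, hw4⟩ := hw
  have ky := hkeep y hyp hyq hxy.symm
  rw [hcy] at ky
  have kw := hkeep w hw1 hw2 hw3
  have hxy_fix : h x = x ∧ h y = y := by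
    have hne : h x ≠ h y := fun e => hxy (h.injective e)
    rcases hc w with e | e <;> rw [e] at kw <;> grind
  have hfix : ∀ z, z ≠ p → z ≠ q → h z = z := by
    intro z h1 h2
    by_cases h3 : z = x
    · rw [h3]; exact hxy_fix.1
    by_cases h4 : z = y
    · rw [h4]; exact hxy_fix.2
    rcases (hkeep z h1 h2 h3).1 with e | e
    · exact e
    · exfalso
      rcases hc z with e' | e' <;> rw [e'] at e
      · exact h3 (h.injective (e.trans hxy_fix.1.symm))
      · exact h4 (h.injective (e.trans hxy_fix.2.symm))
  rcases eq_one_or_eq_swap h hfix with e | e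
  · exact e
  · exact absurd (e ▸ hH) hswap

/-- Proper subgroups of a point stabilizer. -/
lemma hasBaseLE_of_lt_stabilizer {H : Subgroup (Perm α)} {a : α}
    (hle : H ≤ stabilizer (Perm α) a) (hne : H ≠ stabilizer (Perm α) a) :
    HasBaseLE H (Fintype.card α - 2) := by
  have hfixa : ∀ h ∈ H, h a = a := fun h hh => by simpa using hle hh
  obtain ⟨x, y, hxa, hya, hxy, hswap⟩ :
      ∃ x y, x ≠ a ∧ y ≠ a ∧ x ≠ y ∧ swap x y ∉ H := by
    by_contra! hc
    refine hne (le_antisymm hle fun g hg => ?_)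
    have key : ∀ (k : ℕ) (g : Perm α), g.support.card = k → g a = a → g ∈ H := by
      intro k
      induction k using Nat.strong_induction_on with
      | _ k ih =>
        intro g hk hga
        by_cases h1 : g = 1
        · rw [h1]; exact H.one_mem
        obtain ⟨x, hx⟩ : ∃ x, g x ≠ x := by
          by_contra! hh
          exact h1 (Equiv.ext hh)
        have hxa : x ≠ a := fun e => hx (e ▸ hga)
        have hgxa : g x ≠ a := fun e => hxa (g.injective (e.trans hga.symm))
        have hs := hc x (g x) hxa hgxa (Ne.symm hx)
        have hlt := Perm.card_support_swap_mul hx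
        have hmem := ih _ (hk ▸ hlt) (swap x (g x) * g) rfl (by
          rw [Perm.mul_apply, hga, swap_apply_of_ne_of_ne hxa.symm hgxa.symm])
        exact (H.mul_mem_cancel_left hs).1 hmem
    exact key _ g rfl (by simpa using hg)
  have hcard : ({a, x, y} : Finset α).card = 3 := by
    rw [Finset.card_eq_three]; exact ⟨a, x, y, hxa.symm, hya.symm, hxy, rfl⟩
  have hle3 : 3 ≤ Fintype.card α := hcard ▸ Finset.card_le_univ _
  refine ⟨insert 1 (({a, x, y} : Finset α)ᶜ.image fun z => swap a z), ?_, fun h hT => ?_⟩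
  · refine (card_insert_image_le _).trans ?_
    omega
  have hH : h ∈ H := by simpa using hT 1 (Finset.mem_insert_self _ _)
  have hfix : ∀ z, z ≠ x → z ≠ y → h z = z := by
    intro z h1 h2
    by_cases hza : z = a
    · rw [hza]; exact hfixa h hH
    have := hfixa _ (hT (swap a z)
      (Finset.mem_insert_of_mem (Finset.mem_image_of_mem _ (by simp [*]))))
    have := congrArg (swap a z) this
    simpa using this
  rcases eq_one_or_eq_swap h hfix with e | e
  · exact e
  · exact absurd (e ▸ hH) hswap

/-- Groups leaving invariant a set with at least two points inside and at least two outside. -/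
lemma hasBaseLE_of_invariant_set {H : Subgroup (Perm α)} (hn : 5 ≤ Fintype.card α) {Δ : Set α}
    (hinv : ∀ h ∈ H, ∀ z, h z ∈ Δ ↔ z ∈ Δ) {p x q y : α} (hp : p ∈ Δ) (hx : x ∈ Δ)
    (hpx : p ≠ x) (hq : q ∉ Δ) (hy : y ∉ Δ) (hqy : q ≠ y) :
    HasBaseLE H (Fintype.card α - 2) := by
  have hpin : ∀ u v, u ∈ Δ → v ∉ Δ → PinsPair H u v := by
    intro u v hu hv h hh ht
    have huv : u ≠ v := fun e => hv (e ▸ hu)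
    have h1 := hinv _ ht u
    have h2 := hinv _ ht v
    have h3 := hinv h hh u
    have h4 := hinv h hh v
    simp only [Perm.mul_apply, swap_apply_left, swap_apply_right] at h1 h2
    rw [swap_apply_def] at h1 h2
    grind
  obtain ⟨w, hw⟩ : ∃ w, w ∉ ({p, q, x, y} : Finset α) := by
    by_contra! hc
    have := Finset.card_le_card (fun z _ => hc z : (Finset.univ : Finset α) ⊆ _)
    have h4 : ({p, q, x, y} : Finset α).card ≤ 4 := Finset.card_le_four
    rw [Finset.card_univ] at this
    omega
  simp only [Finset.mem_insert, Finset.mem_singleton, not_or] at hw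
  have ne : ∀ u v, u ∈ Δ → v ∉ Δ → u ≠ v := fun u v hu hv e => hv (e ▸ hu)
  refine hasBaseLE_of_pinsPair (ne _ _ hp hq) hpx (ne _ _ hx hq).symm (ne _ _ hx hy)
    (ne _ _ hp hy).symm hqy.symm hw ?_ (hpin _ _ hx hy) ?_
  · intro hs
    exact hq (by simpa using (hinv _ hs p).2 hp)
  · intro z _ _ _ _
    by_cases hz : z ∈ Δ
    · exact Or.inr (hpin _ _ hz hy)
    · exact Or.inl (hpin _ _ hx hz).symm

/-- Groups leaving invariant an equivalence relation with classes of size at least three. -/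
lemma hasBaseLE_of_large_classes {H : Subgroup (Perm α)} (r : Setoid α)
    (hinv : ∀ h ∈ H, ∀ u v, r (h u) (h v) ↔ r u v)
    (hthree : ∀ u, ∃ v w, v ≠ u ∧ w ≠ u ∧ v ≠ w ∧ r u v ∧ r u w) (hne : ∃ u v, ¬ r u v) :
    HasBaseLE H (Fintype.card α - 2) := by
  have hrefl : ∀ u, r u u := r.refl
  have hsymm : ∀ {u v}, r u v → r v u := fun h => r.symm h
  have htrans : ∀ {u v w}, r u v → r v w → r u w := fun h h' => r.trans h h'
  have hhalf : ∀ u v, ¬ r u v → ∀ h ∈ H, swap u v * h * swap u v ∈ H → h u = u ∨ h u = v := by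
    intro u v huv h hh ht
    obtain ⟨u₁, u₂, h1, h2, h12, r1, r2⟩ := hthree u
    have hv1 : u₁ ≠ v := fun e => huv (e ▸ r1)
    have hv2 : u₂ ≠ v := fun e => huv (e ▸ r2)
    by_contra! hc
    have k1 := (hinv _ ht u₁ v).1
    have k2 := (hinv _ ht u₂ v).1
    simp only [Perm.mul_apply, swap_apply_right, swap_apply_of_ne_of_ne h1 hv1,
      swap_apply_of_ne_of_ne h2 hv2, swap_apply_of_ne_of_ne hc.1 hc.2] at k1 k2
    have s1 := (hinv h hh u₁ u).2 (hsymm r1)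
    have s2 := (hinv h hh u₂ u).2 (hsymm r2)
    have s12 := htrans s1 (hsymm s2)
    have t1 : h u₁ = u ∨ h u₁ = v := by
      by_contra! hd
      rw [swap_apply_of_ne_of_ne hd.1 hd.2] at k1
      exact huv (htrans r1 (k1 s1))
    have t2 : h u₂ = u ∨ h u₂ = v := by
      by_contra! hd
      rw [swap_apply_of_ne_of_ne hd.1 hd.2] at k2
      exact huv (htrans r2 (k2 s2))
    have hn12 : h u₁ ≠ h u₂ := fun e => h12 (h.injective e)
    rcases t1 with t1 | t1 <;> rcases t2 with t2 | t2
    · exact hn12 (t1.trans t2.symm)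
    · rw [t1, t2] at s12; exact huv s12
    · rw [t1, t2] at s12; exact huv (hsymm s12)
    · exact hn12 (t1.trans t2.symm)
  have hpin : ∀ u v, ¬ r u v → PinsPair H u v := by
    intro u v huv h hh ht
    refine ⟨hhalf u v huv h hh ht, ?_⟩
    rw [swap_comm] at ht
    exact (hhalf v u (fun e => huv (hsymm e)) h hh ht).symm
  obtain ⟨x, y, hxy⟩ := hne
  obtain ⟨p, w, hpx, hwx, hpw, rp, rw'⟩ := hthree x
  obtain ⟨q, -, hqy, -, -, rq, -⟩ := hthree y
  have hpq : ¬ r p q := fun e => hxy (htrans (htrans rp e) (hsymm rq))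
  have hxq : ¬ r x q := fun e => hxy (htrans e (hsymm rq))
  have hpy : ¬ r p y := fun e => hxy (htrans rp e)
  have hwq : ¬ r w q := fun e => hxq (htrans rw' e)
  have hwy : ¬ r w y := fun e => hxy (htrans rw' e)
  have ne : ∀ {u v}, ¬ r u v → u ≠ v := fun h e => h (e ▸ hrefl _)
  refine hasBaseLE_of_pinsPair (ne hpq) hpx (ne hxq).symm (ne hxy) (ne hpy).symm hqy.symm
    ⟨hpw.symm, ne hwq, hwx, ne hwy⟩ ?_ (hpin _ _ hxy) ?_
  · intro hs
    have := (hinv _ hs p x).2 (hsymm rp)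
    rw [swap_apply_left, swap_apply_of_ne_of_ne hpx.symm (ne hxq)] at this
    exact hxq (hsymm this)
  · intro z _ _ _ _
    by_cases hz : r z x
    · exact Or.inr (hpin _ _ fun e => hxy (htrans (hsymm hz) e))
    · exact Or.inl (hpin _ _ hz)

/-- Groups leaving invariant an equivalence relation with classes of size two. -/
lemma hasBaseLE_of_pairs {H : Subgroup (Perm α)} (hcf : H.normalCore = ⊥)
    (hn : 5 ≤ Fintype.card α) (r : Setoid α)
    (hinv : ∀ h ∈ H, ∀ u v, r (h u) (h v) ↔ r u v)
    (m : α → α) (hm : ∀ u, m u ≠ u) (hr : ∀ u v, r u v ↔ v = u ∨ v = m u) :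
    HasBaseLE H (Fintype.card α - 2) := by
  classical
  have hsymm : ∀ {u v}, r u v → r v u := fun h => r.symm h
  have hmm : ∀ u, m (m u) = u := fun u => by
    have := (hr (m u) u).1 (hsymm ((hr u (m u)).2 (Or.inr rfl)))
    grind
  obtain ⟨x⟩ : Nonempty α := Fintype.card_pos_iff.1 (by omega)
  obtain ⟨p, hp⟩ : ∃ p, p ∉ ({x, m x} : Finset α) := by
    by_contra! hc
    have := Finset.card_le_card (fun z _ => hc z : (Finset.univ : Finset α) ⊆ _)
    have h4 : ({x, m x} : Finset α).card ≤ 2 := Finset.card_le_two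
    rw [Finset.card_univ] at this
    omega
  obtain ⟨q, hq⟩ : ∃ q, q ∉ ({x, m x, p, m p} : Finset α) := by
    by_contra! hc
    have := Finset.card_le_card (fun z _ => hc z : (Finset.univ : Finset α) ⊆ _)
    have h4 : ({x, m x, p, m p} : Finset α).card ≤ 4 := Finset.card_le_four
    rw [Finset.card_univ] at this
    omega
  simp only [Finset.mem_insert, Finset.mem_singleton, not_or] at hp hq
  have hcard : ({x, m x, p, q} : Finset α).card = 4 := by
    rw [Finset.card_insert_of_notMem (by grind), Finset.card_insert_of_notMem (by grind),
      Finset.card_pair (by grind)]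
  have hle : 4 ≤ Fintype.card α := hcard ▸ Finset.card_le_univ _
  have hmh : ∀ h ∈ H, ∀ u, h (m u) = m (h u) := by
    intro h hh u
    have := (hr _ _).1 ((hinv h hh u (m u)).2 ((hr _ _).2 (Or.inr rfl)))
    exact this.resolve_left fun e => hm u (h.injective e)
  let T : Finset (Perm α) := insert 1 (({x, m x, p, q} : Finset α)ᶜ.image fun z => swap x z)
  have hTcard : T.card ≤ Fintype.card α - 3 := by
    refine (card_insert_image_le _).trans ?_
    omega
  have hT : ∀ h, (∀ g ∈ T, g⁻¹ * h * g ∈ H) → h = 1 ∨ ∀ z, h z = m z := by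
    intro h hh
    have hH : h ∈ H := by simpa using hh 1 (Finset.mem_insert_self _ _)
    have hc : ∀ z, z ≠ x → z ≠ m x → z ≠ p → z ≠ q →
        swap x z * h * swap x z ∈ H := by
      intro z h1 h2 h3 h4
      have := hh (swap x z)
        (Finset.mem_insert_of_mem (Finset.mem_image_of_mem _ (by simp [*])))
      simpa using this
    have hmz := hmh h hH
    have hstep : ∀ z, z ≠ x → z ≠ m x → swap x z * h * swap x z ∈ H →
        (h x = x ∨ h x = m x ∨ h x = z ∨ h x = m z) ∧
        (h x = x → h z = z) ∧ (h x = m x → h z = m z) := by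
      intro z h1 h2 hz
      have hmz' := hmh _ hz
      have e1 := hmz' z
      have e2 := hmz' x
      simp only [Perm.mul_apply, swap_apply_left, swap_apply_right] at e1 e2
      have f1 : m z ≠ x := fun e => h2 (by rw [← e, hmm])
      rw [swap_apply_of_ne_of_ne f1 (hm z), hmz] at e1
      rw [swap_apply_of_ne_of_ne (hm x) h2.symm, hmz] at e2
      have i1 : h x = h z → x = z := fun e => h.injective e
      have i2 : h x = m (h z) → x = m z := fun e => h.injective (by rw [hmz, e])
      have := hmm x
      have := hmm z
      have := hmm (h x)
      have := hmm (h z)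
      have := hm x
      have := hm z
      have := hm (h x)
      have := hm (h z)
      simp only [swap_apply_def] at e1 e2
      grind
    have hmp : m p ≠ x ∧ m p ≠ m x ∧ m p ≠ p ∧ m p ≠ q := by
      have := hmm p; have := hmm x; have := hm p
      grind
    have hmq : m q ≠ x ∧ m q ≠ m x ∧ m q ≠ p ∧ m q ≠ q := by
      have := hmm p; have := hmm x; have := hm q; have := hmm q
      grind
    have sp := hstep (m p) hmp.1 hmp.2.1 (hc _ hmp.1 hmp.2.1 hmp.2.2.1 hmp.2.2.2)
    have sq := hstep (m q) hmq.1 hmq.2.1 (hc _ hmq.1 hmq.2.1 hmq.2.2.1 hmq.2.2.2)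
    have hx : h x = x ∨ h x = m x := by
      have := hmm p; have := hmm q
      grind
    have hpq : ∀ z, z ≠ x → z ≠ m x → (h x = x → h z = z) ∧ (h x = m x → h z = m z) := by
      intro z h1 h2
      by_cases hzp : z = p
      · have a1 := sp.2.1; have a2 := sp.2.2
        rw [hmz p, hmm] at a2
        rw [hmz p] at a1
        have b1 := hmm (h p)
        have b2 := hmm p
        subst hzp
        grind
      by_cases hzq : z = q
      · have a1 := sq.2.1; have a2 := sq.2.2
        rw [hmz q, hmm] at a2
        rw [hmz q] at a1
        have b1 := hmm (h q)
        have b2 := hmm q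
        subst hzq
        grind
      exact (hstep z h1 h2 (hc z h1 h2 hzp hzq)).2
    rcases hx with hx | hx
    · left
      ext z
      by_cases h1 : z = x
      · simpa [h1] using hx
      by_cases h2 : z = m x
      · simp [h2, hmz, hx]
      simpa using (hpq z h1 h2).1 hx
    · right
      intro z
      by_cases h1 : z = x
      · simpa [h1] using hx
      by_cases h2 : z = m x
      · simp [h2, hmz, hx]
      exact (hpq z h1 h2).2 hx
  by_cases hτ : ∃ τ : Perm α, τ ≠ 1 ∧ ∀ z, τ z = m z
  · obtain ⟨τ, hτ1, hτm⟩ := hτ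
    obtain ⟨g, hg⟩ : ∃ g : Perm α, g * τ * g⁻¹ ∉ H := by
      by_contra! hc
      have : τ ∈ H.normalCore := hc
      rw [hcf] at this
      exact hτ1 (by simpa using this)
    refine ⟨insert g⁻¹ T, (Finset.card_insert_le _ _).trans (by omega), fun h hh => ?_⟩
    rcases hT h fun k hk => hh k (Finset.mem_insert_of_mem hk) with e | e
    · exact e
    · have hhτ : h = τ := by ext z; rw [e, hτm]
      have := hh g⁻¹ (Finset.mem_insert_self _ _)
      rw [inv_inv, hhτ] at this
      exact absurd this hg
  · refine ⟨T, by omega, fun h hh => ?_⟩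
    rcases hT h hh with e | e
    · exact e
    · by_contra h1
      exact hτ ⟨h, h1, e⟩

lemma hasBaseLE_of_imprimitive {H : Subgroup (Perm α)} (hcf : H.normalCore = ⊥)
    (hn : 5 ≤ Fintype.card α) (ht : IsPretransitive H α) (hH : ¬ IsPreprimitive H α) :
    HasBaseLE H (Fintype.card α - 2) := by
  obtain ⟨r, hinv, ⟨a, b, hab, rab⟩, hne⟩ := exists_invariant_setoid ht hH
  have hmove : ∀ u v : α, ∃ h ∈ H, h u = v := by
    intro u v
    obtain ⟨g, hg⟩ := exists_smul_eq H u v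
    exact ⟨g, g.2, hg⟩
  by_cases hthree : ∃ u v w, v ≠ u ∧ w ≠ u ∧ v ≠ w ∧ r u v ∧ r u w
  · obtain ⟨u, v, w, h1, h2, h3, r1, r2⟩ := hthree
    refine hasBaseLE_of_large_classes r hinv (fun z => ?_) hne
    obtain ⟨h, hh, rfl⟩ := hmove u z
    exact ⟨h v, h w, by simpa, by simpa, by simpa, (hinv h hh _ _).2 r1, (hinv h hh _ _).2 r2⟩
  · have hmate : ∀ u, ∃ v, v ≠ u ∧ r u v := by
      intro u
      obtain ⟨h, hh, rfl⟩ := hmove a u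
      exact ⟨h b, by simpa using hab.symm, (hinv h hh _ _).2 rab⟩
    choose m hm hrm using hmate
    refine hasBaseLE_of_pairs hcf hn r hinv m hm fun u v => ⟨fun huv => ?_, ?_⟩
    · by_contra! hc
      exact hthree ⟨u, v, m u, hc.1, hm u, hc.2, huv, hrm u⟩
    · rintro (rfl | rfl)
      · exact r.refl _
      · exact hrm u

lemma hasBaseLE_of_intransitive {H : Subgroup (Perm α)} (hn : 5 ≤ Fintype.card α)
    (hst : ∀ a : α, H ≠ stabilizer (Perm α) a) (ht : ¬ IsPretransitive H α) :
    HasBaseLE H (Fintype.card α - 2) := by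
  by_cases hfix : ∃ a, ∀ h ∈ H, h a = a
  · obtain ⟨a, ha⟩ := hfix
    exact hasBaseLE_of_lt_stabilizer (fun h hh => by simpa using ha h hh) (hst a)
  push Not at hfix
  obtain ⟨x, y, hxy⟩ : ∃ x y : α, ∀ h ∈ H, h x ≠ y := by
    by_contra! hc
    refine ht ⟨fun x y => ?_⟩
    obtain ⟨h, hh, e⟩ := hc x y
    exact ⟨⟨h, hh⟩, e⟩
  obtain ⟨g, hg, hgx⟩ := hfix x
  obtain ⟨k, hk, hky⟩ := hfix y
  have hinv : ∀ h ∈ H, ∀ z, h z ∈ {z | ∃ h ∈ H, h x = z} ↔ z ∈ {z | ∃ h ∈ H, h x = z} := by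
    intro h hh z
    constructor
    · rintro ⟨h', hh', e⟩
      exact ⟨h⁻¹ * h', H.mul_mem (H.inv_mem hh) hh', by simp [e]⟩
    · rintro ⟨h', hh', e⟩
      exact ⟨h * h', H.mul_mem hh hh', by simp [e]⟩
  have hy : y ∉ {z | ∃ h ∈ H, h x = z} := by
    rintro ⟨h, hh, e⟩
    exact hxy h hh e
  exact hasBaseLE_of_invariant_set hn hinv (p := g x) (x := x) (q := k y) (y := y) ⟨g, hg, rfl⟩
    ⟨1, H.one_mem, rfl⟩ hgx (fun hc => hy ((hinv k hk y).1 hc)) hy hky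

end BaseSize

section DoubleSwaps

variable {α : Type*} [DecidableEq α]

/-- The supports of the products of two disjoint transpositions lying in `H`. -/
def doubleSwapSupports (H : Subgroup (Perm α)) : Set (Finset α) :=
  {A | ∃ a b c d, a ≠ b ∧ a ≠ c ∧ a ≠ d ∧ b ≠ c ∧ b ≠ d ∧ c ≠ d ∧
    swap a b * swap c d ∈ H ∧ A = {a, b, c, d}}

/-- `H` contains no 3-cycle. -/
def NoThreeCycle (H : Subgroup (Perm α)) : Prop :=
  ∀ a b c : α, a ≠ b → a ≠ c → b ≠ c → swap a b * swap a c ∉ H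

section Supports

variable {H : Subgroup (Perm α)}

lemma card_of_mem_doubleSwapSupports {A : Finset α} (hA : A ∈ doubleSwapSupports H) :
    A.card = 4 := by
  obtain ⟨a, b, c, d, h1, h2, h3, h4, h5, h6, -, rfl⟩ := hA
  rw [Finset.card_insert_of_notMem (by grind), Finset.card_insert_of_notMem (by grind),
    Finset.card_pair h6]

/-- A support can be labelled starting from any of its points. -/
lemma exists_labels {A : Finset α} (hA : A ∈ doubleSwapSupports H) {a : α} (ha : a ∈ A) :
    ∃ b c d, a ≠ b ∧ a ≠ c ∧ a ≠ d ∧ b ≠ c ∧ b ≠ d ∧ c ≠ d ∧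
      swap a b * swap c d ∈ H ∧ A = {a, b, c, d} := by
  obtain ⟨x, y, z, w, h1, h2, h3, h4, h5, h6, hs, rfl⟩ := hA
  have hcomm : swap z w * swap x y ∈ H := by
    have hd : Perm.Disjoint (swap x y) (swap z w) := by
      refine Perm.disjoint_swap_swap ?_
      simp [*]
    rwa [← hd.commute.eq]
  simp only [Finset.mem_insert, Finset.mem_singleton] at ha
  rcases ha with rfl | rfl | rfl | rfl
  · exact ⟨y, z, w, h1, h2, h3, h4, h5, h6, hs, rfl⟩
  · exact ⟨x, z, w, h1.symm, h4, h5, h2, h3, h6, by rwa [swap_comm], by grind⟩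
  · exact ⟨w, x, y, h6, h2.symm, h4.symm, h3.symm, h5.symm, h1, hcomm, by grind⟩
  · exact ⟨z, x, y, h6.symm, h3.symm, h5.symm, h2.symm, h4.symm, h1, by rwa [swap_comm a],
      by grind⟩

lemma image_mem_doubleSwapSupports {A : Finset α} (hA : A ∈ doubleSwapSupports H) {h : Perm α}
    (hh : h ∈ H) : A.image h ∈ doubleSwapSupports H := by
  obtain ⟨a, b, c, d, h1, h2, h3, h4, h5, h6, hs, rfl⟩ := hA
  refine ⟨h a, h b, h c, h d, by simpa, by simpa, by simpa, by simpa, by simpa, by simpa, ?_,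
    by simp [Finset.image_insert]⟩
  have : swap (h a) (h b) * swap (h c) (h d) = h * (swap a b * swap c d) * h⁻¹ := by
    rw [swap_apply_apply, swap_apply_apply]
    group
  rw [this]
  exact H.mul_mem (H.mul_mem hh hs) (H.inv_mem hh)

/-- A group without 3-cycles and with no double transposition pins every pair. -/
lemma pinsPair_of_no_doubleSwap (h3 : NoThreeCycle H) (hS : doubleSwapSupports H = ∅) {x y : α}
    (hxy : x ≠ y) : PinsPair H x y := by
  intro h hh ht
  have hmem : swap x y * swap (h x) (h y) ∈ H := by
    have : swap x y * swap (h x) (h y) = swap x y * h * swap x y * h⁻¹ := by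
      rw [swap_apply_apply]
      group
    rw [this]
    exact H.mul_mem ht (H.inv_mem hh)
  have hne : h x ≠ h y := fun e => hxy (h.injective e)
  generalize h x = u at *
  generalize h y = v at *
  have h4 : u ≠ x → u ≠ y → v ≠ x → v ≠ y → False := by
    intro h1 h2 h3 h4
    have : ({x, y, u, v} : Finset α) ∈ doubleSwapSupports H :=
      ⟨x, y, u, v, hxy, h1.symm, h3.symm, h2.symm, h4.symm, hne, hmem, rfl⟩
    rw [hS] at this
    exact this
  have k1 : u = x → v ≠ y → v ≠ x → False := by
    rintro rfl h1 h2
    exact h3 u y v hxy h2.symm h1.symm hmem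
  have k2 : u = y → v ≠ y → v ≠ x → False := by
    rintro rfl h1 h2
    rw [swap_comm x] at hmem
    exact h3 u x v hxy.symm hne h2.symm hmem
  have k3 : v = x → u ≠ y → u ≠ x → False := by
    rintro rfl h1 h2
    rw [swap_comm u] at hmem
    exact h3 v y u hxy h2.symm h1.symm hmem
  have k4 : v = y → u ≠ y → u ≠ x → False := by
    rintro rfl h1 h2
    rw [swap_comm x, swap_comm u] at hmem
    exact h3 v x u hxy.symm hne.symm h2.symm hmem
  grind

lemma card_inter_ne_one (h3 : NoThreeCycle H) {A B : Finset α} (hA : A ∈ doubleSwapSupports H)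
    (hB : B ∈ doubleSwapSupports H) : (A ∩ B).card ≠ 1 := by
  intro hcard
  obtain ⟨a, ha⟩ := Finset.card_eq_one.1 hcard
  have haAB : a ∈ A ∩ B := ha ▸ Finset.mem_singleton_self a
  obtain ⟨haA, haB⟩ := Finset.mem_inter.1 haAB
  obtain ⟨b, c, d, h1, h2, h3', h4, h5, h6, hs, rfl⟩ := exists_labels hA haA
  obtain ⟨e, f, g, k1, k2, k3, k4, k5, k6, hs', rfl⟩ := exists_labels hB haB
  have key : ∀ z, z ∈ ({a, b, c, d} : Finset α) → z ∈ ({a, e, f, g} : Finset α) → z = a := by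
    intro z hz hz'
    exact Finset.mem_singleton.1 (ha ▸ Finset.mem_inter.2 ⟨hz, hz'⟩)
  have hb := key b (by simp)
  have hc := key c (by simp)
  have hd := key d (by simp)
  simp only [Finset.mem_insert, Finset.mem_singleton] at hb hc hd
  have eb : b ≠ e := by grind
  have e1 : (swap a e * swap f g) a = e := by
    rw [Perm.mul_apply, swap_apply_of_ne_of_ne k2 k3, swap_apply_left]
  have e2 : ∀ z, z ≠ a → z ≠ e → z ≠ f → z ≠ g → (swap a e * swap f g) z = z := by
    intro z z1 z2 z3 z4
    rw [Perm.mul_apply, swap_apply_of_ne_of_ne z3 z4, swap_apply_of_ne_of_ne z1 z2]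
  have hconj := H.mul_mem (H.mul_mem hs' hs) (H.inv_mem hs')
  have heq : (swap a e * swap f g) * (swap a b * swap c d) * (swap a e * swap f g)⁻¹
      = swap e b * swap c d := by
    have q1 := swap_apply_apply (swap a e * swap f g) a b
    have q2 := swap_apply_apply (swap a e * swap f g) c d
    rw [e1, e2 b (by grind) (by grind) (by grind) (by grind)] at q1
    rw [e2 c (by grind) (by grind) (by grind) (by grind),
      e2 d (by grind) (by grind) (by grind) (by grind)] at q2
    rw [← conj_mul, ← q1, ← q2]
  rw [heq] at hconj
  have := H.mul_mem hs (H.inv_mem hconj)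
  simp only [mul_inv_rev, swap_inv] at this
  rw [mul_assoc, swap_mul_self_mul, swap_comm a b, swap_comm e b] at this
  exact h3 b a e h1.symm eb k1 this

/-- The only nonempty union of components of the hypergraph of supports is everything. -/
lemma eq_univ_of_closed (hprim : PreservesOnlyTrivial H) (hS : (doubleSwapSupports H).Nonempty)
    {U : Set α} (hU : ∀ D ∈ doubleSwapSupports H, (∀ x ∈ D, x ∈ U) ∨ ∀ x ∈ D, x ∉ U)
    (hne : U.Nonempty) : U = Set.univ := by
  let r : Setoid α :=
    { r := fun u v => ∀ U : Set α,
        (∀ D ∈ doubleSwapSupports H, (∀ x ∈ D, x ∈ U) ∨ ∀ x ∈ D, x ∉ U) → (u ∈ U ↔ v ∈ U)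
      iseqv := ⟨fun _ _ _ => Iff.rfl, fun h U hU => (h U hU).symm,
        fun h h' U hU => (h U hU).trans (h' U hU)⟩ }
  have hinv : ∀ h ∈ H, ∀ u v, r u v → r (h u) (h v) := by
    intro h hh u v huv U hU
    refine huv {x | h x ∈ U} fun D hD => ?_
    simpa using hU _ (image_mem_doubleSwapSupports hD hh)
  rcases hprim r hinv with h | h
  · exfalso
    obtain ⟨A, a, b, c, d, hab, h2, h3, h4, h5, h6, hs, rfl⟩ := hS
    refine hab (h a b fun U hU => ?_)
    rcases hU {a, b, c, d} ⟨a, b, c, d, hab, h2, h3, h4, h5, h6, hs, rfl⟩ with k | k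
    · exact iff_of_true (k a (by simp)) (k b (by simp))
    · exact iff_of_false (k a (by simp)) (k b (by simp))
  · obtain ⟨u, hu⟩ := hne
    exact Set.eq_univ_of_forall fun v => (h u v U hU).1 hu

/-- Supports separate points. -/
lemma exists_separating [Fintype α] (hn : 5 ≤ Fintype.card α) (hprim : PreservesOnlyTrivial H)
    (hS : (doubleSwapSupports H).Nonempty) {u v : α} (huv : u ≠ v) :
    ∃ D ∈ doubleSwapSupports H, ¬ (u ∈ D ↔ v ∈ D) := by
  let r : Setoid α :=
    { r := fun u v => ∀ D ∈ doubleSwapSupports H, (u ∈ D ↔ v ∈ D)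
      iseqv := ⟨fun _ _ _ => Iff.rfl, fun h D hD => (h D hD).symm,
        fun h h' D hD => (h D hD).trans (h' D hD)⟩ }
  have hinv : ∀ h ∈ H, ∀ u v, r u v → r (h u) (h v) := by
    intro h hh u v huv D hD
    have := huv _ (image_mem_doubleSwapSupports hD (H.inv_mem hh))
    simpa [Equiv.symm_apply_eq] using this
  rcases hprim r hinv with h | h
  · by_contra! hc
    exact huv (h u v hc)
  · exfalso
    obtain ⟨D, hD⟩ := hS
    have h4 := card_of_mem_doubleSwapSupports hD
    obtain ⟨a, ha⟩ := Finset.card_pos.1 (by omega : 0 < D.card)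
    have : D = Finset.univ := Finset.eq_univ_iff_forall.2 fun z => (h a z D hD).1 ha
    rw [this, Finset.card_univ] at h4
    omega

/-- If all 4-subsets of `F` are supports, a support cannot meet `F` in few points. -/
lemma card_sdiff_lt_three (h3 : NoThreeCycle H) {F D : Finset α}
    (hF : ∀ A ⊆ F, A.card = 4 → A ∈ doubleSwapSupports H) (hD : D ∈ doubleSwapSupports H)
    (h1 : 1 ≤ (D ∩ F).card) : (F \ D).card < 3 := by
  by_contra! hc
  obtain ⟨x, hx⟩ := Finset.card_pos.1 h1
  obtain ⟨hxD, hxF⟩ := Finset.mem_inter.1 hx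
  obtain ⟨E, hE, hEcard⟩ := Finset.exists_subset_card_eq hc
  have hxE : x ∉ E := fun h => (Finset.mem_sdiff.1 (hE h)).2 hxD
  have hA : insert x E ∈ doubleSwapSupports H := by
    refine hF _ (fun z hz => ?_) (by rw [Finset.card_insert_of_notMem hxE, hEcard])
    rcases Finset.mem_insert.1 hz with rfl | hz
    · exact hxF
    · exact (Finset.mem_sdiff.1 (hE hz)).1
  refine card_inter_ne_one h3 hA hD (Finset.card_eq_one.2 ⟨x, ?_⟩)
  ext z
  have := @hE z
  simp only [Finset.mem_inter, Finset.mem_insert, Finset.mem_singleton, Finset.mem_sdiff] at this ⊢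
  grind

/-- Supports meeting in three points span a set of five points on which `H` acts transitively. -/
lemma exists_move_of_card_inter_eq_three (h3 : NoThreeCycle H) {A B : Finset α}
    (hA : A ∈ doubleSwapSupports H) (hB : B ∈ doubleSwapSupports H) (hAB : (A ∩ B).card = 3) :
    ∀ x ∈ A ∪ B, ∀ y ∈ A ∪ B, ∃ h ∈ H, h x = y ∧ ∀ z, z ∉ A ∪ B → h z = z := by
  have hA4 := card_of_mem_doubleSwapSupports hA
  have hB4 := card_of_mem_doubleSwapSupports hB
  obtain ⟨d, hd⟩ := Finset.card_pos.1
    (by have := Finset.card_inter_add_card_sdiff A B; omega : 0 < (A \ B).card)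
  obtain ⟨e, he⟩ := Finset.card_pos.1
    (by have := Finset.card_inter_add_card_sdiff B A; rw [Finset.inter_comm] at this; omega :
      0 < (B \ A).card)
  obtain ⟨hdA, hdB⟩ := Finset.mem_sdiff.1 hd
  obtain ⟨heB, heA⟩ := Finset.mem_sdiff.1 he
  obtain ⟨c, a, b, h1, h2, h3', h4, h5, h6, hs, hAeq⟩ := exists_labels hA hdA
  obtain ⟨u, v, w, k1, k2, k3, k4, k5, k6, hs', hBeq⟩ := exists_labels hB heB
  have hsub : A ∩ B = {c, a, b} := by
    refine Finset.eq_of_subset_of_card_le (fun z hz => ?_) ?_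
    · obtain ⟨hz1, hz2⟩ := Finset.mem_inter.1 hz
      rw [hAeq] at hz1
      have : z ≠ d := fun e => hdB (e ▸ hz2)
      simpa [this] using hz1
    · rw [hAB]; exact Finset.card_le_three
  have hmem : ∀ z ∈ ({c, a, b} : Finset α), z ∈ B ∧ z ≠ e := by
    intro z hz
    rw [← hsub] at hz
    obtain ⟨hz1, hz2⟩ := Finset.mem_inter.1 hz
    exact ⟨hz2, fun e' => heA (e' ▸ hz1)⟩
  have hc := hmem c (by simp)
  have ha := hmem a (by simp)
  have hb := hmem b (by simp)
  rw [hBeq] at hc ha hb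
  simp only [Finset.mem_insert, Finset.mem_singleton] at hc ha hb
  have hde : d ≠ e := fun e' => heA (e' ▸ hdA)
  have hucase : u = c ∨ u = a ∨ u = b := by grind
  have main : ∀ a b c d e : α, [a, b, c, d, e].Nodup → swap a b * swap c d ∈ H →
      swap a e * swap b c ∈ H → ∀ x ∈ ({a, b, c, d, e} : Finset α),
      ∀ y ∈ ({a, b, c, d, e} : Finset α),
      ∃ h ∈ H, h x = y ∧ ∀ z, z ∉ ({a, b, c, d, e} : Finset α) → h z = z := by
    intro a b c d e hnd hs hs'
    simp only [List.nodup_cons, List.mem_cons, List.not_mem_nil, or_false, not_or,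
      List.nodup_nil, not_false_eq_true, and_true] at hnd
    let ρ : Perm α := (swap a b * swap c d) * (swap a e * swap b c)
    have hρ : ρ ∈ H := H.mul_mem hs hs'
    have re : ρ e = b := by simp only [ρ, Perm.mul_apply, swap_apply_def]; grind
    have rb : ρ b = d := by simp only [ρ, Perm.mul_apply, swap_apply_def]; grind
    have rd : ρ d = c := by simp only [ρ, Perm.mul_apply, swap_apply_def]; grind
    have rc : ρ c = a := by simp only [ρ, Perm.mul_apply, swap_apply_def]; grind
    have rz : ∀ z, z ∉ ({a, b, c, d, e} : Finset α) → ρ z = z := by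
      intro z hz
      simp only [Finset.mem_insert, Finset.mem_singleton, not_or] at hz
      simp only [ρ, Perm.mul_apply, swap_apply_def]
      grind
    have rzpow : ∀ k : ℕ, ∀ z, z ∉ ({a, b, c, d, e} : Finset α) → (ρ ^ k) z = z := by
      intro k z hz
      induction k with
      | zero => simp
      | succ k ih => rw [pow_succ, Perm.mul_apply, rz z hz, ih]
    have hreach : ∀ x ∈ ({a, b, c, d, e} : Finset α), ∃ k : ℕ, (ρ ^ k) e = x := by
      intro x hx
      simp only [Finset.mem_insert, Finset.mem_singleton] at hx
      rcases hx with rfl | rfl | rfl | rfl | rfl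
      · exact ⟨4, by simp [pow_succ, re, rb, rd, rc]⟩
      · exact ⟨1, by simp [re]⟩
      · exact ⟨3, by simp [pow_succ, re, rb, rd]⟩
      · exact ⟨2, by simp [pow_succ, re, rb]⟩
      · exact ⟨0, by simp⟩
    intro x hx y hy
    obtain ⟨k, hk⟩ := hreach x hx
    obtain ⟨l, hl⟩ := hreach y hy
    refine ⟨ρ ^ l * (ρ ^ k)⁻¹, H.mul_mem (H.pow_mem hρ _) (H.inv_mem (H.pow_mem hρ _)), ?_, ?_⟩
    · rw [Perm.mul_apply, Perm.inv_eq_iff_eq.2 hk.symm, hl]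
    · intro z hz
      rw [Perm.mul_apply, Perm.inv_eq_iff_eq.2 (rzpow k z hz).symm, rzpow l z hz]
  rcases hucase with hu | hu | hu
  · exfalso
    have hvw : swap v w = swap a b := by
      have : (v = a ∧ w = b) ∨ (v = b ∧ w = a) := by grind
      rcases this with ⟨rfl, rfl⟩ | ⟨rfl, rfl⟩
      · rfl
      · exact swap_comm _ _
    have := H.mul_mem hs (H.inv_mem hs')
    rw [hvw, hu, mul_inv_rev, swap_inv, swap_inv, mul_assoc, swap_mul_self_mul, swap_comm d c,
      swap_comm e c] at this
    exact h3 c d e h1.symm hc.2 hde this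
  · have hvw : swap v w = swap b c := by
      have : (v = b ∧ w = c) ∨ (v = c ∧ w = b) := by grind
      rcases this with ⟨rfl, rfl⟩ | ⟨rfl, rfl⟩
      · rfl
      · exact swap_comm _ _
    have hunion : A ∪ B = {a, b, c, d, e} := by
      rw [hAeq, hBeq]; ext z; simp only [Finset.mem_union, Finset.mem_insert, Finset.mem_singleton]
      grind
    rw [hunion]
    refine main a b c d e ?_ ?_ ?_
    · simp only [List.nodup_cons, List.mem_cons, List.not_mem_nil, or_false, not_or,
        List.nodup_nil, not_false_eq_true, and_true]
      grind
    · have hd : Perm.Disjoint (swap a b) (swap c d) := by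
        refine Perm.disjoint_swap_swap ?_
        simp only [List.nodup_cons, List.mem_cons, List.not_mem_nil, or_false, not_or,
          List.nodup_nil, not_false_eq_true, and_true]
        grind
      rw [hd.commute.eq, swap_comm c d]
      exact hs
    · rw [swap_comm a e, ← hvw, ← hu]
      exact hs'
  · have hvw : swap v w = swap a c := by
      have : (v = a ∧ w = c) ∨ (v = c ∧ w = a) := by grind
      rcases this with ⟨rfl, rfl⟩ | ⟨rfl, rfl⟩
      · rfl
      · exact swap_comm _ _
    have hunion : A ∪ B = {b, a, c, d, e} := by
      rw [hAeq, hBeq]; ext z; simp only [Finset.mem_union, Finset.mem_insert, Finset.mem_singleton]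
      grind
    rw [hunion]
    refine main b a c d e ?_ ?_ ?_
    · simp only [List.nodup_cons, List.mem_cons, List.not_mem_nil, or_false, not_or,
        List.nodup_nil, not_false_eq_true, and_true]
      grind
    · have hd : Perm.Disjoint (swap b a) (swap c d) := by
        refine Perm.disjoint_swap_swap ?_
        simp only [List.nodup_cons, List.mem_cons, List.not_mem_nil, or_false, not_or,
          List.nodup_nil, not_false_eq_true, and_true]
        grind
      rw [hd.commute.eq, swap_comm c d, swap_comm b a]
      exact hs
    · rw [swap_comm b e, ← hvw, ← hu]
      exact hs'

variable [Fintype α]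

/-- A support which is neither contained in `U` nor disjoint from it. -/
lemma exists_crossing (hprim : PreservesOnlyTrivial H) (hS : (doubleSwapSupports H).Nonempty)
    {U : Finset α} (hne : U.Nonempty) (hU : U.card < Fintype.card α) :
    ∃ D ∈ doubleSwapSupports H, 1 ≤ (D ∩ U).card ∧ (D ∩ U).card ≤ 3 := by
  by_contra! hc
  have : (U : Set α) = Set.univ := by
    refine eq_univ_of_closed hprim hS (fun D hD => ?_) hne
    have h4 := card_of_mem_doubleSwapSupports hD
    have hle := Finset.card_le_card (Finset.inter_subset_left : D ∩ U ⊆ D)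
    by_cases h0 : (D ∩ U).card = 0
    · right
      intro x hx hxU
      rw [Finset.card_eq_zero] at h0
      exact Finset.notMem_empty x (h0 ▸ Finset.mem_inter.2 ⟨hx, hxU⟩)
    · left
      have := hc D hD (by omega)
      have heq := Finset.eq_of_subset_of_card_le (Finset.inter_subset_left : D ∩ U ⊆ D) (by omega)
      intro x hx
      rw [← heq] at hx
      exact (Finset.mem_inter.1 hx).2
  rw [Finset.coe_eq_univ] at this
  rw [this, Finset.card_univ] at hU
  omega

end Supports

end DoubleSwaps

section Unions

variable {α : Type*} [DecidableEq α] {H : Subgroup (Perm α)}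

lemma apply_mem_of_fixes_compl {F : Finset α} {h : Perm α} (hfix : ∀ z, z ∉ F → h z = z) {z : α}
    (hz : z ∈ F) : h z ∈ F := by
  by_contra hc
  exact hc ((h.injective (hfix _ hc)).symm ▸ hz)

/-- Supports meeting in three points span a set all of whose 4-subsets are supports. -/
lemma mem_doubleSwapSupports_of_subset_union (h3 : NoThreeCycle H) {A B : Finset α}
    (hA : A ∈ doubleSwapSupports H) (hB : B ∈ doubleSwapSupports H) (hAB : (A ∩ B).card = 3) :
    ∀ C ⊆ A ∪ B, C.card = 4 → C ∈ doubleSwapSupports H := by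
  intro C hC hC4
  have hA4 := card_of_mem_doubleSwapSupports hA
  have hB4 := card_of_mem_doubleSwapSupports hB
  have h5 := Finset.card_union_add_card_inter A B
  obtain ⟨e, he⟩ := Finset.card_pos.1 (by
    have := Finset.card_sdiff_add_card_eq_card (Finset.subset_union_left : A ⊆ A ∪ B)
    omega : 0 < ((A ∪ B) \ A).card)
  obtain ⟨x, hx⟩ := Finset.card_pos.1 (by
    have := Finset.card_sdiff_add_card_eq_card hC
    omega : 0 < ((A ∪ B) \ C).card)
  rw [Finset.mem_sdiff] at he hx
  obtain ⟨h, hh, hex, hfix⟩ := exists_move_of_card_inter_eq_three h3 hA hB hAB e he.1 x hx.1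
  have hCeq : C = (A ∪ B).erase x := by
    refine Finset.eq_of_subset_of_card_le (fun z hz => ?_) ?_
    · exact Finset.mem_erase.2 ⟨fun e => hx.2 (e ▸ hz), hC hz⟩
    · rw [Finset.card_erase_of_mem hx.1]
      omega
  have himg : A.image h = C := by
    refine Finset.eq_of_subset_of_card_le (fun y hy => ?_) ?_
    · obtain ⟨z, hz, rfl⟩ := Finset.mem_image.1 hy
      rw [hCeq, Finset.mem_erase, ← hex]
      exact ⟨fun e' => he.2 (h.injective e' ▸ hz),
        apply_mem_of_fixes_compl hfix (Finset.mem_union_left _ hz)⟩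
    · rw [Finset.card_image_of_injective _ h.injective]
      omega
  rw [← himg]
  exact image_mem_doubleSwapSupports hA hh

lemma card_inter_ne_three [Fintype α] (hn : 7 ≤ Fintype.card α) (hprim : PreservesOnlyTrivial H)
    (h3 : NoThreeCycle H) {A B : Finset α} (hA : A ∈ doubleSwapSupports H)
    (hB : B ∈ doubleSwapSupports H) : (A ∩ B).card ≠ 3 := by
  intro hAB
  have hA4 := card_of_mem_doubleSwapSupports hA
  have hB4 := card_of_mem_doubleSwapSupports hB
  have h5 := Finset.card_union_add_card_inter A B
  have hfull := mem_doubleSwapSupports_of_subset_union h3 hA hB hAB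
  have hmove := exists_move_of_card_inter_eq_three h3 hA hB hAB
  generalize A ∪ B = F at *
  obtain ⟨D, hD, hD1, hD3⟩ := exists_crossing hprim ⟨A, hA⟩ (U := F)
    (Finset.card_pos.1 (by omega)) (by omega)
  have hD4 := card_of_mem_doubleSwapSupports hD
  have hFD := card_sdiff_lt_three h3 hfull hD hD1
  have hFD' := Finset.card_inter_add_card_sdiff F D
  have hDF' := Finset.card_inter_add_card_sdiff D F
  rw [Finset.inter_comm] at hFD'
  obtain ⟨A', hDA', hA'F, hA'4⟩ := Finset.exists_subsuperset_card_eq (n := 4)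
    (Finset.inter_subset_right : D ∩ F ⊆ F) (by omega) (by omega)
  have hA' := hfull A' hA'F hA'4
  have hinter : A' ∩ D = D ∩ F := by grind
  have hfull' := mem_doubleSwapSupports_of_subset_union h3 hA' hD (by rw [hinter]; omega)
  obtain ⟨z, hz⟩ := Finset.card_pos.1 (by omega : 0 < (D \ F).card)
  rw [Finset.mem_sdiff] at hz
  have hT : (insert z F).card = 6 := by
    rw [Finset.card_insert_of_notMem hz.2]
    omega
  obtain ⟨e, heq⟩ := Finset.card_eq_one.1 (by
    have := Finset.card_sdiff_add_card_eq_card hA'F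
    omega : (F \ A').card = 1)
  have he : e ∈ F \ A' := by simp [heq]
  have hfull6 : ∀ C ⊆ insert z F, C.card = 4 → C ∈ doubleSwapSupports H := by
    intro C hC hC4
    by_cases hzC : z ∈ C
    · obtain ⟨x, hx⟩ := Finset.card_pos.1 (by
        have h6 := Finset.card_sdiff_add_card_eq_card hC
        omega : 0 < (insert z F \ C).card)
      rw [Finset.mem_sdiff, Finset.mem_insert] at hx
      have hxF : x ∈ F := by grind
      obtain ⟨h, hh, hxe, hfix⟩ := hmove x hxF e (Finset.mem_sdiff.1 he).1
      have himg : C.image h ∈ doubleSwapSupports H := by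
        refine hfull' _ (fun y hy => ?_) (by rwa [Finset.card_image_of_injective _ h.injective])
        obtain ⟨c, hc, rfl⟩ := Finset.mem_image.1 hy
        rcases Finset.mem_insert.1 (hC hc) with rfl | hcF
        · rw [hfix _ hz.2]
          exact Finset.mem_union_right _ hz.1
        · refine Finset.mem_union_left _ ?_
          by_contra hcon
          have : h c ∈ F \ A' :=
            Finset.mem_sdiff.2 ⟨apply_mem_of_fixes_compl hfix hcF, hcon⟩
          rw [heq, Finset.mem_singleton, ← hxe] at this
          exact hx.2 (h.injective this ▸ hc)
      have := image_mem_doubleSwapSupports himg (H.inv_mem hh)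
      simpa [Finset.image_image] using this
    · exact hfull C (fun c hc => by grind) hC4
  obtain ⟨D', hD', hD1', hD3'⟩ := exists_crossing hprim ⟨A, hA⟩ (U := insert z F)
    (Finset.card_pos.1 (by omega)) (by omega)
  have h7 := card_sdiff_lt_three h3 hfull6 hD' hD1'
  have h8 := Finset.card_inter_add_card_sdiff (insert z F) D'
  rw [Finset.inter_comm] at h8
  omega

lemma even_card_inter [Fintype α] (hn : 7 ≤ Fintype.card α) (hprim : PreservesOnlyTrivial H)
    (h3 : NoThreeCycle H) {A B : Finset α} (hA : A ∈ doubleSwapSupports H)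
    (hB : B ∈ doubleSwapSupports H) : Even (A ∩ B).card := by
  have h1 := card_inter_ne_one h3 hA hB
  have h2 := card_inter_ne_three hn hprim h3 hA hB
  have h4 := Finset.card_le_card (Finset.inter_subset_left : A ∩ B ⊆ A)
  rw [card_of_mem_doubleSwapSupports hA] at h4
  interval_cases (A ∩ B).card <;> first | exact absurd rfl ‹_› | decide

end Unions

section Labellings

variable {α : Type*} [DecidableEq α] {H : Subgroup (Perm α)}

lemma card_filter_mem_eq_sum {β ι : Type*} [DecidableEq ι] (v : β → ι) (D : Finset β)
    (s : Finset ι) :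
    (D.filter fun x => v x ∈ s).card = ∑ i ∈ s, (D.filter fun x => v x = i).card := by
  rw [Finset.card_eq_sum_card_fiberwise (f := v) (t := s) (by intro x; simp)]
  refine Finset.sum_congr rfl fun i hi => ?_
  congr 1
  ext x
  simp only [Finset.mem_filter]
  grind

/-- Three supports `A k`, a map `v` recording membership in them as a binary number, and a point
`X i` for each nonzero value `i` of `v`, at which alone `v` takes this value. -/
structure FanoLabelling (H : Subgroup (Perm α)) (A : Fin 3 → Finset α) (v : α → Fin 8)
    (X : Fin 8 → α) : Prop where
  mem : ∀ k, A k ∈ doubleSwapSupports H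
  mem_iff : ∀ k x, x ∈ A k ↔ (v x).val.testBit k = true
  eq_iff : ∀ i ≠ 0, ∀ x, v x = i ↔ x = X i

variable [Fintype α]

lemma card_inter_eq_two (hn : 7 ≤ Fintype.card α) (hprim : PreservesOnlyTrivial H)
    (h3 : NoThreeCycle H) {A B : Finset α} (hA : A ∈ doubleSwapSupports H)
    (hB : B ∈ doubleSwapSupports H) {x y : α} (hxA : x ∈ A) (hxB : x ∈ B) (hyA : y ∈ A)
    (hyB : y ∉ B) : (A ∩ B).card = 2 := by
  obtain ⟨k, hk⟩ := even_card_inter hn hprim h3 hA hB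
  have h1 : 0 < (A ∩ B).card := Finset.card_pos.2 ⟨x, Finset.mem_inter.2 ⟨hxA, hxB⟩⟩
  have h2 : (A ∩ B).card < A.card :=
    Finset.card_lt_card (Finset.ssubset_iff_subset_ne.2 ⟨Finset.inter_subset_left,
      fun e => hyB (Finset.mem_inter.1 (e.symm ▸ hyA)).2⟩)
  rw [card_of_mem_doubleSwapSupports hA] at h2
  omega

lemma exists_labelling (hn : 7 ≤ Fintype.card α) (hprim : PreservesOnlyTrivial H)
    (h3 : NoThreeCycle H) (hS : (doubleSwapSupports H).Nonempty) :
    ∃ (A : Fin 3 → Finset α) (v : α → Fin 8) (X : Fin 8 → α), FanoLabelling H A v X := by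
  obtain ⟨A, hA⟩ := id hS
  obtain ⟨a, b, c, d, hab, -, -, -, -, -, -, hAeq⟩ := id hA
  have haA : a ∈ A := by simp [hAeq]
  have hbA : b ∈ A := by simp [hAeq]
  obtain ⟨B, hB, hBsep⟩ := exists_separating (by omega) hprim hS hab
  have hAB : (A ∩ B).card = 2 := by
    by_cases haB : a ∈ B
    · exact card_inter_eq_two hn hprim h3 hA hB haA haB hbA (by tauto)
    · exact card_inter_eq_two hn hprim h3 hA hB hbA (by tauto) haA haB
  obtain ⟨p, q, hpq, hABeq⟩ := Finset.card_eq_two.1 hAB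
  have hp : p ∈ A ∩ B := by simp [hABeq]
  have hq : q ∈ A ∩ B := by simp [hABeq]
  rw [Finset.mem_inter] at hp hq
  obtain ⟨C, hC, hCsep⟩ := exists_separating (by omega) hprim hS hpq
  have key : ∃ p q, p ∈ A ∧ p ∈ B ∧ p ∈ C ∧ q ∈ A ∧ q ∈ B ∧ q ∉ C ∧ A ∩ B = {p, q} := by
    by_cases hpC : p ∈ C
    · exact ⟨p, q, hp.1, hp.2, hpC, hq.1, hq.2, by tauto, hABeq⟩
    · exact ⟨q, p, hq.1, hq.2, by tauto, hp.1, hp.2, hpC, by rw [hABeq, Finset.pair_comm]⟩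
  clear hp hq hpq hCsep hABeq p q
  obtain ⟨p, q, hpA, hpB, hpC, hqA, hqB, hqC, hABeq⟩ := key
  have hAC := card_inter_eq_two hn hprim h3 hA hC hpA hpC hqA hqC
  have hBC := card_inter_eq_two hn hprim h3 hB hC hpB hpC hqB hqC
  have hABC : (A ∩ B ∩ C).card = 1 := by
    rw [Finset.card_eq_one]
    refine ⟨p, ?_⟩
    rw [hABeq]
    ext x
    simp only [Finset.mem_inter, Finset.mem_insert, Finset.mem_singleton]
    grind
  have hlabel : ∀ x : α, ∃ i : Fin 8, ∀ k : Fin 3,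
      i.val.testBit k = decide (x ∈ (![A, B, C] : Fin 3 → Finset α) k) := by
    have : ∀ t : Fin 3 → Bool, ∃ i : Fin 8, ∀ k : Fin 3, i.val.testBit k = t k := by decide
    exact fun x => this _
  choose v hv using hlabel
  have hvA : ∀ x, x ∈ A ↔ v x ∈ ({1, 3, 5, 7} : Finset (Fin 8)) := by
    intro x
    have h1 : ∀ i : Fin 8, i.val.testBit (0 : Fin 3) = true ↔
      i ∈ ({1, 3, 5, 7} : Finset (Fin 8)) := by decide
    rw [← h1, hv]
    exact decide_eq_true_iff.symm
  have hvB : ∀ x, x ∈ B ↔ v x ∈ ({2, 3, 6, 7} : Finset (Fin 8)) := by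
    intro x
    have h1 : ∀ i : Fin 8, i.val.testBit (1 : Fin 3) = true ↔
      i ∈ ({2, 3, 6, 7} : Finset (Fin 8)) := by decide
    rw [← h1, hv]
    exact decide_eq_true_iff.symm
  have hvC : ∀ x, x ∈ C ↔ v x ∈ ({4, 5, 6, 7} : Finset (Fin 8)) := by
    intro x
    have h1 : ∀ i : Fin 8, i.val.testBit (2 : Fin 3) = true ↔
      i ∈ ({4, 5, 6, 7} : Finset (Fin 8)) := by decide
    rw [← h1, hv]
    exact decide_eq_true_iff.symm
  have hcount : ∀ (D : Finset α) (s : Finset (Fin 8)), (∀ x, x ∈ D ↔ v x ∈ s) →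
      D.card = ∑ i ∈ s, (Finset.univ.filter fun x => v x = i).card := by
    intro D s h
    rw [← card_filter_mem_eq_sum]
    congr 1
    ext x
    simp [h]
  have cA := hcount A _ hvA
  have cB := hcount B _ hvB
  have cC := hcount C _ hvC
  have cAB := hcount (A ∩ B) ({3, 7} : Finset (Fin 8)) fun x => by
    rw [Finset.mem_inter, hvA, hvB]; generalize v x = i; revert i; decide
  have cAC := hcount (A ∩ C) ({5, 7} : Finset (Fin 8)) fun x => by
    rw [Finset.mem_inter, hvA, hvC]; generalize v x = i; revert i; decide
  have cBC := hcount (B ∩ C) ({6, 7} : Finset (Fin 8)) fun x => by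
    rw [Finset.mem_inter, hvB, hvC]; generalize v x = i; revert i; decide
  have cABC := hcount (A ∩ B ∩ C) ({7} : Finset (Fin 8)) fun x => by
    rw [Finset.mem_inter, Finset.mem_inter, hvA, hvB, hvC]; generalize v x = i; revert i; decide
  rw [card_of_mem_doubleSwapSupports hA] at cA
  rw [card_of_mem_doubleSwapSupports hB] at cB
  rw [card_of_mem_doubleSwapSupports hC] at cC
  rw [hAB] at cAB
  rw [hAC] at cAC
  rw [hBC] at cBC
  rw [hABC] at cABC
  have hone : ∀ i : Fin 8, i ≠ 0 → ∃ y, (Finset.univ.filter fun x => v x = i) = {y} := by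
    intro i hi
    rw [← Finset.card_eq_one]
    obtain ⟨N, hN⟩ : ∃ N : Fin 8 → ℕ, ∀ i, (Finset.univ.filter fun x => v x = i).card = N i :=
      ⟨_, fun _ => rfl⟩
    simp [hN] at cA cB cC cAB cAC cBC cABC
    rw [hN]
    fin_cases i <;> simp at hi ⊢ <;> omega
  have : Nonempty α := ⟨p⟩
  choose! X hX using hone
  refine ⟨![A, B, C], v, X, ?_, ?_, ?_⟩
  · intro k
    fin_cases k <;> assumption
  · intro k x
    rw [hv]
    exact decide_eq_true_iff.symm
  · intro i hi x
    have := congrArg (x ∈ ·) (hX i hi)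
    simpa using this

end Labellings

section FanoLabellings

variable {α : Type*} [DecidableEq α] {H : Subgroup (Perm α)}

lemma FanoLabelling.card_filter {A : Fin 3 → Finset α} {v : α → Fin 8} {X : Fin 8 → α}
    (hL : FanoLabelling H A v X) (D : Finset α) {i : Fin 8} (hi : i ≠ 0) :
    (D.filter fun x => v x = i).card = (decide (X i ∈ D)).toNat := by
  simp only [hL.eq_iff i hi]
  rw [Finset.filter_eq']
  split_ifs with h <;> simp [h]

lemma FanoLabelling.card_eq {A : Fin 3 → Finset α} {v : α → Fin 8} {X : Fin 8 → α}
    (hL : FanoLabelling H A v X) (D : Finset α) :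
    D.card = (D.filter fun x => v x = 0).card + ((decide (X 1 ∈ D)).toNat +
      (decide (X 2 ∈ D)).toNat + (decide (X 3 ∈ D)).toNat + (decide (X 4 ∈ D)).toNat +
      (decide (X 5 ∈ D)).toNat + (decide (X 6 ∈ D)).toNat + (decide (X 7 ∈ D)).toNat) := by
  have h := card_filter_mem_eq_sum v D Finset.univ
  simp only [Finset.mem_univ, Finset.filter_true] at h
  rw [h, Fin.sum_univ_eight, hL.card_filter D (i := 1) (by decide),
    hL.card_filter D (i := 2) (by decide), hL.card_filter D (i := 3) (by decide),
    hL.card_filter D (i := 4) (by decide), hL.card_filter D (i := 5) (by decide),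
    hL.card_filter D (i := 6) (by decide), hL.card_filter D (i := 7) (by decide)]
  ring

/-- The relations satisfied by the traces of the supports on the seven labelled points. -/
def IsHammingWord (w : Fin 8 → Bool) : Prop :=
  (w 1 ^^ w 3 ^^ w 5 ^^ w 7) = false ∧ (w 2 ^^ w 3 ^^ w 6 ^^ w 7) = false ∧
    (w 4 ^^ w 5 ^^ w 6 ^^ w 7) = false

lemma FanoLabelling.isHammingWord [Fintype α] (hn : 7 ≤ Fintype.card α)
    (hprim : PreservesOnlyTrivial H) (h3 : NoThreeCycle H)
    {A : Fin 3 → Finset α} {v : α → Fin 8} {X : Fin 8 → α}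
    (hL : FanoLabelling H A v X) {D : Finset α} (hD : D ∈ doubleSwapSupports H) :
    IsHammingWord fun i => decide (X i ∈ D) := by
  have hcount : ∀ (k : Fin 3) (a b c d : Fin 8), [a, b, c, d, 0].Nodup →
      (∀ i : Fin 8, i.val.testBit k = true ↔ i ∈ ({a, b, c, d} : Finset (Fin 8))) →
      (decide (X a ∈ D) ^^ decide (X b ∈ D) ^^ decide (X c ∈ D) ^^ decide (X d ∈ D)) = false := by
    intro k a b c d hnd hbit
    simp only [List.nodup_cons, List.mem_cons, List.not_mem_nil, or_false, not_or,
      List.nodup_nil, not_false_eq_true, and_true] at hnd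
    have heq : D ∩ A k = D.filter fun x => v x ∈ ({a, b, c, d} : Finset (Fin 8)) := by
      ext x
      rw [Finset.mem_inter, Finset.mem_filter, hL.mem_iff, hbit]
    have heven := even_card_inter hn hprim h3 hD (hL.mem k)
    rw [heq, card_filter_mem_eq_sum, Finset.sum_insert (by grind), Finset.sum_insert (by grind),
      Finset.sum_pair (by grind), hL.card_filter D (by grind), hL.card_filter D (by grind),
      hL.card_filter D (by grind), hL.card_filter D (by grind)] at heven
    revert heven
    generalize decide (X a ∈ D) = p
    generalize decide (X b ∈ D) = q
    generalize decide (X c ∈ D) = r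
    generalize decide (X d ∈ D) = s
    revert p q r s
    decide
  exact ⟨hcount 0 1 3 5 7 (by decide) (by decide), hcount 1 2 3 6 7 (by decide) (by decide),
    hcount 2 4 5 6 7 (by decide) (by decide)⟩

lemma hamming_weight : ∀ a b c d e f g : Bool, (a ^^ c ^^ e ^^ g) = false →
    (b ^^ c ^^ f ^^ g) = false → (d ^^ e ^^ f ^^ g) = false →
    a.toNat + b.toNat + c.toNat + d.toNat + e.toNat + f.toNat + g.toNat ≤ 4 →
    a.toNat + b.toNat + c.toNat + d.toNat + e.toNat + f.toNat + g.toNat = 0 ∨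
    a.toNat + b.toNat + c.toNat + d.toNat + e.toNat + f.toNat + g.toNat = 3 ∨
    a.toNat + b.toNat + c.toNat + d.toNat + e.toNat + f.toNat + g.toNat = 4 := by
  decide +kernel

lemma odd_hamming_overlap : ∀ a b c d e f g : Bool, (a ^^ c ^^ e ^^ g) = false →
    (b ^^ c ^^ f ^^ g) = false → (d ^^ e ^^ f ^^ g) = false →
    a.toNat + b.toNat + c.toNat + d.toNat + e.toNat + f.toNat + g.toNat = 3 →
    ∀ a' b' c' d' e' f' g' : Bool, (a' ^^ c' ^^ e' ^^ g') = false →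
    (b' ^^ c' ^^ f' ^^ g') = false → (d' ^^ e' ^^ f' ^^ g') = false →
    a'.toNat + b'.toNat + c'.toNat + d'.toNat + e'.toNat + f'.toNat + g'.toNat = 3 →
    ((a && a').toNat + (b && b').toNat + (c && c').toNat + (d && d').toNat + (e && e').toNat +
      (f && f').toNat + (g && g').toNat) % 2 = 1 := by decide +kernel

/-- Outside the seven labelled points there is at most one further point. -/
lemma FanoLabelling.injective [Fintype α] (hn : 7 ≤ Fintype.card α)
    (hprim : PreservesOnlyTrivial H) (h3 : NoThreeCycle H)
    {A : Fin 3 → Finset α} {v : α → Fin 8} {X : Fin 8 → α}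
    (hL : FanoLabelling H A v X) : Function.Injective v := by
  have hS : (doubleSwapSupports H).Nonempty := ⟨_, hL.mem 0⟩
  have hX1 : v (X 1) ≠ 0 := by
    rw [(hL.eq_iff 1 (by decide) _).2 rfl]
    decide
  suffices hzero : ∀ x y, v x = 0 → v y = 0 → x = y by
    intro x y hxy
    by_cases hx : v x = 0
    · exact hzero x y hx (hxy ▸ hx)
    · rw [(hL.eq_iff _ hx x).1 rfl, (hL.eq_iff _ hx y).1 hxy.symm]
  by_cases hcl : ∀ D ∈ doubleSwapSupports H, (∃ x ∈ D, v x ≠ 0) → ∀ x ∈ D, v x ≠ 0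
  · have huniv : {x | v x ≠ 0} = Set.univ := by
      refine eq_univ_of_closed hprim hS (fun D hD => ?_) ⟨X 1, hX1⟩
      by_cases h : ∃ x ∈ D, v x ≠ 0
      · exact Or.inl (hcl D hD h)
      · right
        simpa using h
    intro x y hx
    exact absurd hx (huniv.symm ▸ Set.mem_univ x : x ∈ {x | v x ≠ 0})
  push Not at hcl
  obtain ⟨E, hE, ⟨y, hyE, hy⟩, z, hzE, hz⟩ := hcl
  have hE4 := hL.card_eq E
  rw [card_of_mem_doubleSwapSupports hE] at hE4
  obtain ⟨e1, e2, e3⟩ := hL.isHammingWord hn hprim h3 hE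
  beta_reduce at e1 e2 e3
  have hEw := hamming_weight _ _ _ _ _ _ _ e1 e2 e3
  have hE0 : 0 < (E.filter fun x => v x = 0).card :=
    Finset.card_pos.2 ⟨z, Finset.mem_filter.2 ⟨hzE, hz⟩⟩
  have hElt : (E.filter fun x => v x = 0).card < E.card :=
    Finset.card_lt_card (Finset.filter_ssubset.2 ⟨y, hyE, hy⟩)
  rw [card_of_mem_doubleSwapSupports hE] at hElt
  have hEw3 : (decide (X 1 ∈ E)).toNat +
      (decide (X 2 ∈ E)).toNat + (decide (X 3 ∈ E)).toNat + (decide (X 4 ∈ E)).toNat +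
      (decide (X 5 ∈ E)).toNat + (decide (X 6 ∈ E)).toNat + (decide (X 7 ∈ E)).toNat = 3 := by
    omega
  have hEone : ∀ x ∈ E, v x = 0 → x = z := by
    intro x hx hx0
    exact Finset.card_le_one.1 (by omega : (E.filter fun x => v x = 0).card ≤ 1) x
      (Finset.mem_filter.2 ⟨hx, hx0⟩) z (Finset.mem_filter.2 ⟨hzE, hz⟩)
  have huniv : {x | v x ≠ 0 ∨ x = z} = Set.univ := by
    refine eq_univ_of_closed hprim hS (fun D hD => ?_) ⟨z, Or.inr rfl⟩
    have hD4 := hL.card_eq D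
    rw [card_of_mem_doubleSwapSupports hD] at hD4
    obtain ⟨d1, d2, d3⟩ := hL.isHammingWord hn hprim h3 hD
    beta_reduce at d1 d2 d3
    have hDE := hL.card_eq (D ∩ E)
    have heven := even_card_inter hn hprim h3 hD hE
    rw [Nat.even_iff] at heven
    simp only [Finset.mem_inter, Bool.decide_and] at hDE
    have hfil : ((D ∩ E).filter fun x => v x = 0).card = (decide (z ∈ D)).toNat := by
      have : ((D ∩ E).filter fun x => v x = 0) = D.filter (· = z) := by
        ext x
        simp only [Finset.mem_filter, Finset.mem_inter]
        grind
      rw [this, Finset.filter_eq']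
      split_ifs with h <;> simp [h]
    rw [hfil] at hDE
    rcases hamming_weight _ _ _ _ _ _ _ d1 d2 d3 (by omega) with h | h | h
    · right
      have hall : ∀ x ∈ D, v x = 0 := by
        have : D.filter (fun x => v x = 0) = D :=
          Finset.eq_of_subset_of_card_le (Finset.filter_subset _ _)
            (by rw [card_of_mem_doubleSwapSupports hD]; omega)
        exact Finset.filter_eq_self.1 this
      have hzD : z ∉ D := by
        intro hzD
        simp only [Nat.add_eq_zero_iff, Bool.toNat_eq_zero] at h
        obtain ⟨⟨⟨⟨⟨⟨h1, h2⟩, h3⟩, h4⟩, h5⟩, h6⟩, h7⟩ := h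
        simp only [h1, h2, h3, h4, h5, h6, h7, hzD] at hDE
        simp at hDE
        omega
      intro x hx hxU
      rcases hxU with hx0 | rfl
      · exact hx0 (hall x hx)
      · exact hzD hx
    · left
      have hodd := odd_hamming_overlap _ _ _ _ _ _ _ d1 d2 d3 h _ _ _ _ _ _ _ e1 e2 e3 hEw3
      have hzD : z ∈ D := by
        by_contra hzD
        simp only [hzD, decide_false, Bool.toNat_false, Nat.zero_add] at hDE
        rw [hDE] at heven
        omega
      intro x hx
      by_cases hx0 : v x = 0
      · right
        exact Finset.card_le_one.1 (by omega : (D.filter fun x => v x = 0).card ≤ 1) x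
          (Finset.mem_filter.2 ⟨hx, hx0⟩) z (Finset.mem_filter.2 ⟨hzD, hz⟩)
      · exact Or.inl hx0
    · left
      intro x hx
      left
      intro hx0
      have : 0 < (D.filter fun x => v x = 0).card :=
        Finset.card_pos.2 ⟨x, Finset.mem_filter.2 ⟨hx, hx0⟩⟩
      omega
  have hz' : ∀ x, v x = 0 → x = z := by
    intro x hx
    have : x ∈ {x | v x ≠ 0 ∨ x = z} := huniv ▸ Set.mem_univ x
    exact this.resolve_left (not_not.2 hx)
  intro x y hx hy
  rw [hz' x hx, hz' y hy]

end FanoLabellings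

section HammingRelations

variable {α : Type*} [DecidableEq α] {H : Subgroup (Perm α)}

/-- The cyclic permutation `i ↦ j ↦ k ↦ i` of `ℕ`. -/
def threeCycle (i j k n : ℕ) : ℕ :=
  bif n.beq i then j else bif n.beq j then k else bif n.beq k then i else n

/-- The relations satisfied by the labels of the images of the seven labelled points, after
applying `t` to these labels. -/
def hammingRel (t : ℕ → ℕ) (a b c d e f g : ℕ) : Bool :=
  (t a ^^^ t c ^^^ t e ^^^ t g).beq 0 &&
    ((t b ^^^ t c ^^^ t f ^^^ t g).beq 0 && (t d ^^^ t e ^^^ t f ^^^ t g).beq 0)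

lemma hammingRel_iff {t : ℕ → ℕ} {a b c d e f g : ℕ} : hammingRel t a b c d e f g = true ↔
    t a ^^^ t c ^^^ t e ^^^ t g = 0 ∧ t b ^^^ t c ^^^ t f ^^^ t g = 0 ∧
      t d ^^^ t e ^^^ t f ^^^ t g = 0 := by
  simp [hammingRel]

/-- If the images of the labelled points satisfy the Hamming relations, as well as their
conjugates by three 3-cycles, then they are the labelled points themselves. -/
def hammingCheck (a b c d e f g : ℕ) : Bool :=
  !(hammingRel (threeCycle 3 2 1) b c a d e f g && (hammingRel (threeCycle 4 2 1) b d c a e f g &&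
    hammingRel (threeCycle 4 3 1) c b d a e f g)) ||
  (a.beq b || (a.beq c || (a.beq d || (b.beq c || (b.beq d || c.beq d))))) ||
  (a.beq 1 && (b.beq 2 && (c.beq 3 && (d.beq 4 && (e.beq 5 && (f.beq 6 && g.beq 7))))))

lemma hammingCheck_eq_true : ∀ a ∈ List.range 8, ∀ b ∈ List.range 8, ∀ c ∈ List.range 8,
    ∀ e ∈ List.range 8, hammingCheck a b c (e ^^^ (b ^^^ c ^^^ (a ^^^ c ^^^ e)) ^^^ (a ^^^ c ^^^ e))
      e (b ^^^ c ^^^ (a ^^^ c ^^^ e)) (a ^^^ c ^^^ e) = true := by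
  decide +kernel

lemma eq_labels_of_hammingRel {a b c d e f g : ℕ} (ha : a < 8) (hb : b < 8) (hc : c < 8)
    (he : e < 8) (h0 : hammingRel id a b c d e f g)
    (h1 : hammingRel (threeCycle 3 2 1) b c a d e f g)
    (h2 : hammingRel (threeCycle 4 2 1) b d c a e f g)
    (h3 : hammingRel (threeCycle 4 3 1) c b d a e f g)
    (hab : a ≠ b) (hac : a ≠ c) (had : a ≠ d) (hbc : b ≠ c) (hbd : b ≠ d) (hcd : c ≠ d) :
    a = 1 ∧ b = 2 ∧ c = 3 ∧ d = 4 ∧ e = 5 ∧ f = 6 ∧ g = 7 := by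
  obtain ⟨r1, r2, r3⟩ := hammingRel_iff.1 h0
  simp only [id, Nat.xor_eq_zero_iff] at r1 r2 r3
  have hf : f = b ^^^ c ^^^ g := by
    rw [← r2, ← Nat.xor_assoc, Nat.xor_self, Nat.zero_xor]
  have hd : d = e ^^^ f ^^^ g := by
    rw [← r3, Nat.xor_assoc d, Nat.xor_comm d, ← Nat.xor_assoc, Nat.xor_self, Nat.zero_xor]
  subst r1
  subst hf
  subst hd
  have := hammingCheck_eq_true a (List.mem_range.2 ha) b (List.mem_range.2 hb) c
    (List.mem_range.2 hc) e (List.mem_range.2 he)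
  simp only [hammingCheck, h1, h2, h3] at this
  simpa [hab, hac, had, hbc, hbd, hcd] using this

lemma FanoLabelling.hammingRel_of_mem [Fintype α] (hn : 7 ≤ Fintype.card α)
    (hprim : PreservesOnlyTrivial H) (h3 : NoThreeCycle H)
    {A : Fin 3 → Finset α} {v : α → Fin 8} {X : Fin 8 → α}
    (hL : FanoLabelling H A v X) {h : Perm α} (hh : h ∈ H) :
    hammingRel id (v (h (X 1))) (v (h (X 2))) (v (h (X 3))) (v (h (X 4))) (v (h (X 5)))
      (v (h (X 6))) (v (h (X 7))) := by
  have hword : ∀ k : Fin 3, IsHammingWord fun i => (v (h (X i))).val.testBit k := by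
    intro k
    have hw := hL.isHammingWord hn hprim h3 (image_mem_doubleSwapSupports (hL.mem k) (H.inv_mem hh))
    have heq : ∀ i, decide (X i ∈ (A k).image ⇑h⁻¹) = (v (h (X i))).val.testBit k := by
      intro i
      rw [Bool.eq_iff_iff, decide_eq_true_iff, ← hL.mem_iff]
      simp [Equiv.symm_apply_eq]
    simpa only [heq] using hw
  have hzero : ∀ a b c d : Fin 8, (∀ k : Fin 3, (a.val.testBit k ^^ b.val.testBit k ^^
      c.val.testBit k ^^ d.val.testBit k) = false) → a.val ^^^ b.val ^^^ c.val ^^^ d.val = 0 := by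
    intro a b c d hk
    refine Nat.eq_of_testBit_eq fun j => ?_
    rw [Nat.testBit_xor, Nat.testBit_xor, Nat.testBit_xor, Nat.zero_testBit]
    by_cases hj : j < 3
    · simpa using hk ⟨j, hj⟩
    · have hlt : ∀ i : Fin 8, i.val.testBit j = false := fun i =>
        Nat.testBit_lt_two_pow (lt_of_lt_of_le i.isLt
          (Nat.pow_le_pow_right (n := 2) (by decide) (not_lt.1 hj)))
      simp [hlt]
  exact hammingRel_iff.2 ⟨hzero _ _ _ _ fun k => (hword k).1, hzero _ _ _ _ fun k => (hword k).2.1,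
    hzero _ _ _ _ fun k => (hword k).2.2⟩

lemma FanoLabelling.apply_swap_mul_swap {A : Fin 3 → Finset α} {v : α → Fin 8} {X : Fin 8 → α}
    (hL : FanoLabelling H A v X) {i j k : Fin 8} (hi : i ≠ 0) (hj : j ≠ 0) (hk : k ≠ 0)
    (hij : i ≠ j) (hik : i ≠ k) (hjk : j ≠ k) (x : α) :
    (v ((swap (X j) (X k) * swap (X i) (X j)) x) : ℕ) = threeCycle k j i (v x) := by
  have ei : ∀ x, x = X i ↔ v x = i := fun x => (hL.eq_iff i hi x).symm
  have ej : ∀ x, x = X j ↔ v x = j := fun x => (hL.eq_iff j hj x).symm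
  have ek : ∀ x, x = X k ↔ v x = k := fun x => (hL.eq_iff k hk x).symm
  have vi := (ei _).1 rfl
  have vj := (ej _).1 rfl
  have vk := (ek _).1 rfl
  simp only [Perm.mul_apply, swap_apply_def, threeCycle, Bool.cond_eq_ite, Nat.beq_eq, Fin.val_inj,
    ei, ej, ek]
  grind

end HammingRelations

section Primitive

variable {α : Type*} [DecidableEq α] {H : Subgroup (Perm α)}

variable [Fintype α]

/-- A primitive group with double transpositions but no 3-cycle needs at most four conjugates. -/
lemma hasBaseLE_of_doubleSwap (hn : 7 ≤ Fintype.card α) (hprim : PreservesOnlyTrivial H)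
    (h3 : NoThreeCycle H) (hS : (doubleSwapSupports H).Nonempty) :
    HasBaseLE H (Fintype.card α - 2) := by
  obtain ⟨A, v, X, hL⟩ := exists_labelling hn hprim h3 hS
  have hinj := hL.injective hn hprim h3
  have hvX : ∀ i ≠ 0, v (X i) = i := fun i hi => (hL.eq_iff i hi _).2 rfl
  have hXne : ∀ i j, i ≠ 0 → j ≠ 0 → i ≠ j → X i ≠ X j := by
    intro i j hi hj hij h
    rw [← hvX i hi, ← hvX j hj, h] at hij
    exact hij rfl
  let g : Fin 8 → Fin 8 → Fin 8 → Perm α := fun i j k => swap (X i) (X j) * swap (X j) (X k)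
  refine ⟨{1, g 1 2 3, g 1 2 4, g 1 3 4}, Finset.card_le_four.trans (by omega), fun h hT => ?_⟩
  have hrel : ∀ i j k : Fin 8, i ≠ 0 → j ≠ 0 → k ≠ 0 → i ≠ j → i ≠ k → j ≠ k →
      (g i j k)⁻¹ * h * g i j k ∈ H →
      hammingRel (threeCycle k j i) (v (h (g i j k (X 1)))) (v (h (g i j k (X 2))))
        (v (h (g i j k (X 3)))) (v (h (g i j k (X 4)))) (v (h (g i j k (X 5))))
        (v (h (g i j k (X 6)))) (v (h (g i j k (X 7)))) := by
    intro i j k hi hj hk hij hik hjk hmem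
    have := hL.hammingRel_of_mem hn hprim h3 hmem
    simp only [g, mul_inv_rev, swap_inv, Perm.mul_apply (_ * h), Perm.mul_apply _ h,
      hL.apply_swap_mul_swap hi hj hk hij hik hjk] at this
    exact this
  have gi : ∀ i j k : Fin 8, i ≠ 0 → j ≠ 0 → k ≠ 0 → i ≠ j → i ≠ k → j ≠ k →
      g i j k (X i) = X j ∧ g i j k (X j) = X k ∧ g i j k (X k) = X i ∧
      ∀ l, l ≠ 0 → l ≠ i → l ≠ j → l ≠ k → g i j k (X l) = X l := by
    intro i j k hi hj hk hij hik hjk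
    have n1 := hXne i j hi hj hij
    have n2 := hXne i k hi hk hik
    have n3 := hXne j k hj hk hjk
    refine ⟨?_, ?_, ?_, fun l hl hli hlj hlk => ?_⟩
    · rw [Perm.mul_apply, swap_apply_of_ne_of_ne n1 n2, swap_apply_left]
    · rw [Perm.mul_apply, swap_apply_left, swap_apply_of_ne_of_ne n2.symm n3.symm]
    · rw [Perm.mul_apply, swap_apply_right, swap_apply_right]
    · rw [Perm.mul_apply, swap_apply_of_ne_of_ne (hXne l j hl hj hlj) (hXne l k hl hk hlk),
        swap_apply_of_ne_of_ne (hXne l i hl hi hli) (hXne l j hl hj hlj)]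
  have r0 := hL.hammingRel_of_mem hn hprim h3 (h := h) (by simpa using hT 1 (by simp))
  have r1 := hrel 1 2 3 (by decide) (by decide) (by decide) (by decide) (by decide) (by decide)
    (hT _ (by simp))
  have r2 := hrel 1 2 4 (by decide) (by decide) (by decide) (by decide) (by decide) (by decide)
    (hT _ (by simp))
  have r3 := hrel 1 3 4 (by decide) (by decide) (by decide) (by decide) (by decide) (by decide)
    (hT _ (by simp))
  obtain ⟨a1, a2, a3, a4⟩ := gi 1 2 3 (by decide) (by decide) (by decide) (by decide)
    (by decide) (by decide)
  obtain ⟨b1, b2, b3, b4⟩ := gi 1 2 4 (by decide) (by decide) (by decide) (by decide)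
    (by decide) (by decide)
  obtain ⟨c1, c2, c3, c4⟩ := gi 1 3 4 (by decide) (by decide) (by decide) (by decide)
    (by decide) (by decide)
  rw [a1, a2, a3, a4 4 (by decide) (by decide) (by decide) (by decide),
    a4 5 (by decide) (by decide) (by decide) (by decide),
    a4 6 (by decide) (by decide) (by decide) (by decide),
    a4 7 (by decide) (by decide) (by decide) (by decide)] at r1
  rw [b1, b2, b3, b4 3 (by decide) (by decide) (by decide) (by decide),
    b4 5 (by decide) (by decide) (by decide) (by decide),
    b4 6 (by decide) (by decide) (by decide) (by decide),
    b4 7 (by decide) (by decide) (by decide) (by decide)] at r2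
  rw [c1, c2, c3, c4 2 (by decide) (by decide) (by decide) (by decide),
    c4 5 (by decide) (by decide) (by decide) (by decide),
    c4 6 (by decide) (by decide) (by decide) (by decide),
    c4 7 (by decide) (by decide) (by decide) (by decide)] at r3
  have hne : ∀ i j : Fin 8, i ≠ 0 → j ≠ 0 → i ≠ j → (v (h (X i)) : ℕ) ≠ v (h (X j)) :=
    fun i j hi hj hij e => hXne i j hi hj hij (h.injective (hinj (Fin.val_injective e)))
  have hfixed := eq_labels_of_hammingRel (Fin.isLt _) (Fin.isLt _) (Fin.isLt _) (Fin.isLt _)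
    r0 r1 r2 r3 (hne 1 2 (by decide) (by decide) (by decide))
    (hne 1 3 (by decide) (by decide) (by decide)) (hne 1 4 (by decide) (by decide) (by decide))
    (hne 2 3 (by decide) (by decide) (by decide)) (hne 2 4 (by decide) (by decide) (by decide))
    (hne 3 4 (by decide) (by decide) (by decide))
  have hlabel : ∀ i ≠ 0, h (X i) = X i := by
    intro i hi
    refine (hL.eq_iff i hi _).1 (Fin.val_injective ?_)
    obtain ⟨k1, k2, k3, k4, k5, k6, k7⟩ := hfixed
    fin_cases i
    exacts [absurd rfl hi, k1, k2, k3, k4, k5, k6, k7]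
  ext x
  by_cases hx : v x = 0
  · refine hinj ?_
    by_contra hne'
    have hx' : v (h x) ≠ 0 := fun e => hne' (e.trans hx.symm)
    have e1 := (hL.eq_iff _ hx' (h x)).1 rfl
    rw [← hlabel _ hx'] at e1
    have e2 := h.injective e1
    rw [e2, hvX _ hx'] at hx
    exact hx' hx
  · have e1 := (hL.eq_iff _ hx x).1 rfl
    rw [e1, hlabel _ hx]
    rfl

lemma hasBaseLE_of_isPreprimitive (hcf : H.normalCore = ⊥) (hn : 7 ≤ Fintype.card α)
    (hH : IsPreprimitive H α) : HasBaseLE H (Fintype.card α - 2) := by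
  have hnormal : ∀ N : Subgroup (Perm α), N.Normal → N ≤ H → N = ⊥ := fun N hN hle =>
    le_bot_iff.1 (hcf ▸ Subgroup.normal_le_normalCore.2 hle)
  have hnt : Nontrivial α := Fintype.one_lt_card_iff_nontrivial.1 (by omega)
  have hswap : ∀ p q : α, p ≠ q → swap p q ∉ H := by
    intro p q hpq hmem
    have htop := Perm.subgroup_eq_top_of_isPreprimitive_of_isSwap_mem hH (swap p q)
      ⟨p, q, hpq, rfl⟩ hmem
    exact top_ne_bot (hnormal ⊤ inferInstance htop.ge)
  have h3 : NoThreeCycle H := by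
    intro a b c hab hac hbc hmem
    have hle := Perm.alternatingGroup_le_of_isPreprimitive_of_isThreeCycle_mem hH
      (Perm.isThreeCycle_swap_mul_swap_same hab hac hbc) hmem
    have hbot := hnormal _ inferInstance hle
    have : swap a b * swap a c ∈ alternatingGroup α :=
      (Perm.isThreeCycle_swap_mul_swap_same hab hac hbc).mem_alternatingGroup
    rw [hbot, Subgroup.mem_bot, mul_eq_one_iff_eq_inv, swap_inv] at this
    have := congrArg (· a) this
    simp only [swap_apply_left] at this
    exact hbc this
  rcases Set.eq_empty_or_nonempty (doubleSwapSupports H) with hS | hS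
  · obtain ⟨f⟩ : Nonempty (Fin 5 ↪ α) := by
      rw [Function.Embedding.nonempty_iff_card_le, Fintype.card_fin]
      omega
    have hf : ∀ i j, i ≠ j → f i ≠ f j := fun i j hij e => hij (f.injective e)
    exact hasBaseLE_of_pinsPair (p := f 0) (q := f 1) (x := f 2) (y := f 3) (w := f 4)
      (hf _ _ (by decide)) (hf _ _ (by decide)) (hf _ _ (by decide)) (hf _ _ (by decide))
      (hf _ _ (by decide)) (hf _ _ (by decide))
      ⟨hf _ _ (by decide), hf _ _ (by decide), hf _ _ (by decide), hf _ _ (by decide)⟩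
      (hswap _ _ (hf _ _ (by decide)))
      (pinsPair_of_no_doubleSwap h3 hS (hf _ _ (by decide)))
      fun z _ _ hz _ => Or.inl (pinsPair_of_no_doubleSwap h3 hS hz)
  · exact hasBaseLE_of_doubleSwap hn (preservesOnlyTrivial_of_isPreprimitive hH) h3 hS

end Primitive

lemma mem_conjSub_iff {G : Type} [Group G] {g x : G} {H : Subgroup G} :
    x ∈ conjSub g H ↔ g⁻¹ * x * g ∈ H := by
  constructor
  · rintro ⟨y, hy, rfl⟩
    simpa [mul_assoc] using hy
  · exact fun h => ⟨_, h, by simp [mul_assoc]⟩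

/-- Let `n ≥ 7` and `G = Sₙ`. If `H` is a core-free subgroup of `G`
which is not the stabilizer of a point, then some `n - 2` conjugates of `H` intersect
trivially, i.e. `b(G,H) ≤ n - 2`. -/
theorem base_size_symmetric (n : ℕ) (hn : 7 ≤ n) (H : Subgroup (Equiv.Perm (Fin n)))
    (hcf : H.normalCore = ⊥)
    (hst : ∀ a : Fin n, H ≠ MulAction.stabilizer (Equiv.Perm (Fin n)) a) :
    ∃ g : Fin (n - 2) → Equiv.Perm (Fin n), (⨅ i, conjSub (g i) H) = ⊥ := by
  have hcard := Fintype.card_fin n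
  have hbase : HasBaseLE H (Fintype.card (Fin n) - 2) := by
    by_cases ht : IsPretransitive H (Fin n)
    · by_cases hp : IsPreprimitive H (Fin n)
      · exact hasBaseLE_of_isPreprimitive hcf (by omega) hp
      · exact hasBaseLE_of_imprimitive hcf (by omega) ht hp
    · exact hasBaseLE_of_intransitive (by omega) hst ht
  rw [hcard] at hbase
  obtain ⟨T, hT, hbot⟩ := hbase
  refine ⟨fun i => if h : (i : ℕ) < T.card then (T.equivFin.symm ⟨i, h⟩ : Perm (Fin n)) else 1,
    eq_bot_iff.2 fun x hx => Subgroup.mem_bot.2 (hbot x fun g hg => ?_)⟩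
  have hi := (T.equivFin ⟨g, hg⟩).isLt
  have hmem := Subgroup.mem_iInf.1 hx ⟨T.equivFin ⟨g, hg⟩, hi.trans_le hT⟩
  simp only [hi, dite_true, Fin.eta, Equiv.symm_apply_apply] at hmem
  exact mem_conjSub_iff.1 hmem
end
end
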